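/- Let Δ be a graph (a 1-dimensional simplicial complex without isolated vertices). The following conditions are equivalent: (i) I_Δ^m is Cohen–Macaulay for every m ≥ 1; (ii) I_Δ^m is Buchsbaum for some m ≥ 4; (iii) I_Δ^m is quasi-Buchsbaum for some m ≥ 4; (iv) Δ is a complete intersection. -/

import Mathlib

open CategoryTheory Opposite

/-! ### Abstract simplicial complexes -/

/-- An abstract simplicial complex on the vertex set `Fin n`: a collection of finite
subsets (faces) closed under taking subsets. -/
structure SimComplex (n : ℕ) where
  faces : Set (Finset (Fin n))
  down_closed : ∀ ⦃F G : Finset (Fin n)⦄, F ∈ faces → G ⊆ F → G ∈ faces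

namespace SimComplex

variable {n : ℕ}

/-- The vertex set of a simplicial complex. -/
def vertexSet (Δ : SimComplex n) : Set (Fin n) := {v | ({v} : Finset (Fin n)) ∈ Δ.faces}

/-- The dimension of a simplicial complex: the maximal cardinality of a face, minus one. -/
noncomputable def dim (Δ : SimComplex n) : ℤ :=
  (Int.ofNat (sSup (Finset.card '' Δ.faces))) - 1

/-- A facet is a maximal face. -/
def IsFacet (Δ : SimComplex n) (F : Finset (Fin n)) : Prop :=
  F ∈ Δ.faces ∧ ∀ G ∈ Δ.faces, F ⊆ G → F = G

/-- A complex is pure if all facets have the same cardinality. -/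
def Pure (Δ : SimComplex n) : Prop :=
  ∀ F G, Δ.IsFacet F → Δ.IsFacet G → F.card = G.card

/-- A matroid: for any two faces `F`, `G` with `|F| > |G|` there is `i ∈ F ∖ G`
with `G ∪ {i}` a face. -/
def IsMatroid (Δ : SimComplex n) : Prop :=
  ∀ F G, F ∈ Δ.faces → G ∈ Δ.faces → G.card < F.card →
    ∃ i ∈ F, i ∉ G ∧ insert i G ∈ Δ.faces

/-- The link of a face `G`: `{F ∖ G : G ⊆ F ∈ Δ}`. -/
def link (Δ : SimComplex n) (G : Finset (Fin n)) : SimComplex n where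
  faces := {F | Disjoint F G ∧ F ∪ G ∈ Δ.faces}
  down_closed := by
    intro F F' hF hsub
    exact ⟨hF.1.mono_left hsub, Δ.down_closed hF.2 (Finset.union_subset_union hsub subset_rfl)⟩

/-- The star of a face `G`: `{F ∈ Δ : F ∪ G ∈ Δ}`. -/
def star (Δ : SimComplex n) (G : Finset (Fin n)) : SimComplex n where
  faces := {F | F ∈ Δ.faces ∧ F ∪ G ∈ Δ.faces}
  down_closed := by
    intro F F' hF hsub
    exact ⟨Δ.down_closed hF.1 hsub, Δ.down_closed hF.2 (Finset.union_subset_union hsub subset_rfl)⟩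

/-- `Δ` is locally a matroid if the link of every vertex is a matroid. -/
def LocallyMatroid (Δ : SimComplex n) : Prop :=
  ∀ v ∈ Δ.vertexSet, (Δ.link {v}).IsMatroid

/-- Two vertices are adjacent if they span a 1-dimensional face (an edge). -/
def Adj (Δ : SimComplex n) (u v : Fin n) : Prop :=
  u ≠ v ∧ ({u, v} : Finset (Fin n)) ∈ Δ.faces

/-- Two vertices are joined by a path of edges. -/
def Reach (Δ : SimComplex n) : Fin n → Fin n → Prop := Relation.ReflTransGen Δ.Adj

/-- A complex is connected if any two vertices are joined by a path of edges. -/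
def Connected (Δ : SimComplex n) : Prop :=
  ∀ u ∈ Δ.vertexSet, ∀ v ∈ Δ.vertexSet, Δ.Reach u v

/-- The induced subcomplex on a set `W` of vertices. -/
def induced (Δ : SimComplex n) (W : Set (Fin n)) : SimComplex n where
  faces := {F | F ∈ Δ.faces ∧ ↑F ⊆ W}
  down_closed := by
    intro F F' hF hsub
    exact ⟨Δ.down_closed hF.1 hsub, subset_trans (Finset.coe_subset.2 hsub) hF.2⟩

/-- The connected component of a vertex `v`, as an induced subcomplex. -/
def component (Δ : SimComplex n) (v : Fin n) : SimComplex n :=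
  Δ.induced {u | Δ.Reach v u}

/-- A minimal nonface: a subset of the vertex set which is not a face, all of whose
proper subsets are faces. -/
def IsMinNonface (Δ : SimComplex n) (F : Finset (Fin n)) : Prop :=
  ↑F ⊆ Δ.vertexSet ∧ F ∉ Δ.faces ∧ ∀ G ⊂ F, G ∈ Δ.faces

/-- A complete intersection complex: the minimal nonfaces are pairwise disjoint. -/
def IsCompleteIntersection (Δ : SimComplex n) : Prop :=
  ∀ F G, Δ.IsMinNonface F → Δ.IsMinNonface G → F ≠ G → Disjoint F G

/-- `Δ` is locally a complete intersection if the link of every vertex is one. -/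
def LocallyCompleteIntersection (Δ : SimComplex n) : Prop :=
  ∀ v ∈ Δ.vertexSet, (Δ.link {v}).IsCompleteIntersection

/-- A path graph: vertices `f 0, …, f (k+1)` and edges exactly the consecutive pairs. -/
def IsPathGraph (Δ : SimComplex n) : Prop :=
  ∃ (k : ℕ) (f : Fin (k + 2) → Fin n), Function.Injective f ∧
    Δ.vertexSet = Set.range f ∧
    ∀ e : Finset (Fin n), (e ∈ Δ.faces ∧ e.card = 2) ↔
      ∃ i : Fin (k + 1), e = {f i.castSucc, f i.succ}

/-- A cycle graph: vertices `f 0, …, f (k+2)` and edges exactly the cyclically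
consecutive pairs. -/
def IsCycleGraph (Δ : SimComplex n) : Prop :=
  ∃ (k : ℕ) (f : Fin (k + 3) → Fin n), Function.Injective f ∧
    Δ.vertexSet = Set.range f ∧
    ∀ e : Finset (Fin n), (e ∈ Δ.faces ∧ e.card = 2) ↔
      ∃ i : Fin (k + 3), e = {f i, f (i + 1)}

end SimComplex

/-! ### Commutative-algebra notions -/

noncomputable section

/-- The `i`-th Ext group of two modules over a commutative ring. -/
def ExtGroup (A : Type) [CommRing A] (i : ℕ) (M N : Type) [AddCommGroup M] [Module A M]
    [AddCommGroup N] [Module A N] : Type :=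
  ((Ext A (ModuleCat A) i).obj (op (ModuleCat.of A M))).obj (ModuleCat.of A N)

/-- A local ring is Cohen–Macaulay if its depth equals its Krull dimension, i.e. if
`Ext^i(residue field, B)` vanishes for all `i < dim B`. -/
def IsCohenMacaulayLocalRing (B : Type) [CommRing B] [IsLocalRing B] : Prop :=
  ∀ i : ℕ, (i : WithBot ℕ∞) < ringKrullDim B →
    Subsingleton (ExtGroup B i (B ⧸ IsLocalRing.maximalIdeal B) B)

/-- A commutative ring is Cohen–Macaulay if all its localizations at primes are
Cohen–Macaulay local rings. -/
def IsCohenMacaulayRing (A : Type) [CommRing A] : Prop :=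
  ∀ (P : Ideal A) (hP : P.IsPrime),
    letI : P.IsPrime := hP
    IsCohenMacaulayLocalRing (Localization.AtPrime P)

/-- An ideal `I` of `A` is Cohen–Macaulay if `A ⧸ I` is a Cohen–Macaulay ring. -/
def IsCohenMacaulayIdeal {A : Type} [CommRing A] (I : Ideal A) : Prop :=
  IsCohenMacaulayRing (A ⧸ I)

/-- The ideal `I` satisfies Serre's condition `(S₂)`: for every prime `P` of `A`, the
depth of the localized module `(A⧸I)_P` over `A_P` is at least `min {2, height P}`,
where the height of `P` is the Krull dimension of `A_P` and depth is detected by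
vanishing of `Ext^i` from the residue field. -/
def SatisfiesS2 {A : Type} [CommRing A] (I : Ideal A) : Prop :=
  ∀ (P : Ideal A) (hP : P.IsPrime),
    letI : P.IsPrime := hP
    ∀ i : ℕ, (i : WithBot ℕ∞) < min 2 (ringKrullDim (Localization.AtPrime P)) →
      Subsingleton (ExtGroup (Localization.AtPrime P) i
        (Localization.AtPrime P ⧸ IsLocalRing.maximalIdeal (Localization.AtPrime P))
        (LocalizedModule P.primeCompl (A ⧸ I)))

/-- The `m`-th symbolic power of an ideal: the intersection of the `m`-th powers of
its minimal primes. -/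
def symbPowIdeal {A : Type} [CommRing A] (I : Ideal A) (m : ℕ) : Ideal A :=
  ⨅ P ∈ I.minimalPrimes, P ^ m

end

/-! ### Stanley–Reisner theory -/

noncomputable section

open MvPolynomial

/-- The squarefree monomial attached to a finite set of variables. -/
def faceMonomial (K : Type) [Field K] {n : ℕ} (F : Finset (Fin n)) : MvPolynomial (Fin n) K :=
  ∏ i ∈ F, X i

/-- The Stanley–Reisner ideal of a complex on `[n]`: generated by the squarefree
monomials corresponding to nonfaces. -/
def SRIdeal (K : Type) [Field K] {n : ℕ} (Δ : SimComplex n) : Ideal (MvPolynomial (Fin n) K) :=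
  Ideal.span {p | ∃ F : Finset (Fin n), F ∉ Δ.faces ∧ p = faceMonomial K F}

/-- The Stanley–Reisner ideal of a complex whose vertex set may be a proper subset of
`[n]`: generated by the squarefree monomials of nonfaces contained in the vertex set. -/
def SRIdealOn (K : Type) [Field K] {n : ℕ} (Δ : SimComplex n) : Ideal (MvPolynomial (Fin n) K) :=
  Ideal.span {p | ∃ F : Finset (Fin n), ↑F ⊆ Δ.vertexSet ∧ F ∉ Δ.faces ∧ p = faceMonomial K F}

/-- The prime ideal generated by the variables indexed by `F`. -/
def PF (K : Type) [Field K] {n : ℕ} (F : Finset (Fin n)) : Ideal (MvPolynomial (Fin n) K) :=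
  Ideal.span ((fun i => (X i : MvPolynomial (Fin n) K)) '' ↑F)

/-- The `m`-th symbolic power of the Stanley–Reisner ideal:
`I_Δ^{(m)} = ⋂_{F facet} P_{complement of F}^m`. -/
def SRSymbPow (K : Type) [Field K] {n : ℕ} (Δ : SimComplex n) (m : ℕ) :
    Ideal (MvPolynomial (Fin n) K) :=
  ⨅ (F : Finset (Fin n)) (_ : Δ.IsFacet F), (PF K Fᶜ) ^ m

/-- The cover ideal `J(Δ) = ⋂_{F facet} P_F` and its symbolic powers. -/
def coverSymbPow (K : Type) [Field K] {n : ℕ} (Δ : SimComplex n) (m : ℕ) :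
    Ideal (MvPolynomial (Fin n) K) :=
  ⨅ (F : Finset (Fin n)) (_ : Δ.IsFacet F), (PF K F) ^ m

/-- The graded maximal ideal `(x_1, …, x_n)`. -/
def maxIdeal (K : Type) [Field K] (n : ℕ) : Ideal (MvPolynomial (Fin n) K) :=
  Ideal.span (Set.range X)

/-- The `i`-th local cohomology module of `S ⧸ I` with support in the maximal
graded ideal. -/
def locCoh (K : Type) [Field K] {n : ℕ} (i : ℕ) (I : Ideal (MvPolynomial (Fin n) K)) :
    ModuleCat (MvPolynomial (Fin n) K) :=
  (localCohomology (maxIdeal K n) i).obj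
    (ModuleCat.of (MvPolynomial (Fin n) K) (MvPolynomial (Fin n) K ⧸ I))

/-- `I` is quasi-Buchsbaum: the maximal ideal annihilates all local cohomology modules
`H^i_m(S⧸I)` for `i < dim S⧸I`. -/
def IsQuasiBuchsbaum (K : Type) [Field K] {n : ℕ} (I : Ideal (MvPolynomial (Fin n) K)) : Prop :=
  ∀ i : ℕ, (i : WithBot ℕ∞) < ringKrullDim (MvPolynomial (Fin n) K ⧸ I) →
    ∀ x ∈ maxIdeal K n, ∀ y : (locCoh K i I), x • y = 0

/-- `I` is Buchsbaum: for `i < dim S⧸I` the natural map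
`Ext^i_S(S⧸m, S⧸I) → H^i_m(S⧸I)` (the structure map into the direct limit defining local
cohomology) is surjective. -/
def IsBuchsbaum (K : Type) [Field K] {n : ℕ} (I : Ideal (MvPolynomial (Fin n) K)) : Prop :=
  ∀ i : ℕ, (i : WithBot ℕ∞) < ringKrullDim (MvPolynomial (Fin n) K ⧸ I) →
    letI := localCohomology.hasColimitDiagram
      (localCohomology.idealPowersDiagram (maxIdeal K n)) i
    Function.Surjective
      ((CategoryTheory.Limits.colimit.ι
          (localCohomology.diagram (localCohomology.idealPowersDiagram (maxIdeal K n)) i)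
          (Opposite.op (Opposite.op (1 : ℕ)))).app
        (ModuleCat.of (MvPolynomial (Fin n) K) (MvPolynomial (Fin n) K ⧸ I)))

/-- `I` is generalized Cohen–Macaulay: the local cohomology modules `H^i_m(S⧸I)` are
finite-dimensional over `K` for `i < dim S⧸I`. -/
def IsGeneralizedCM (K : Type) [Field K] {n : ℕ} (I : Ideal (MvPolynomial (Fin n) K)) : Prop :=
  ∀ i : ℕ, (i : WithBot ℕ∞) < ringKrullDim (MvPolynomial (Fin n) K ⧸ I) →
    Module.Finite K (RestrictScalars K (MvPolynomial (Fin n) K) (locCoh K i I))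

end

/-! ### Monomial ideals -/

/-- A monomial ideal of `K[x_1,…,x_n]`. -/
def IsMonomialIdeal {K : Type} [Field K] {n : ℕ} (I : Ideal (MvPolynomial (Fin n) K)) : Prop :=
  ∃ S : Set (Fin n →₀ ℕ),
    I = Ideal.span {p | ∃ d ∈ S, p = MvPolynomial.monomial d (1 : K)}

/-- A squarefree monomial ideal of `K[x_1,…,x_n]`. -/
def IsSquarefreeMonomialIdeal {K : Type} [Field K] {n : ℕ}
    (I : Ideal (MvPolynomial (Fin n) K)) : Prop :=
  ∃ S : Set (Finset (Fin n)),
    I = Ideal.span {p | ∃ F ∈ S, p = ∏ i ∈ F, (MvPolynomial.X i : MvPolynomial (Fin n) K)}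

namespace ExtAux
variable {R : Type} [CommRing R]

/-- `c` is a cocycle representing the Ext class `y`. -/
def Rep {X : ModuleCat.{0} R} (P : ProjectiveResolution X) (n : ℕ) (M : ModuleCat.{0} R)
    (y : ((Ext R (ModuleCat.{0} R) n).obj (op X)).obj M) (c : P.complex.X n ⟶ M) : Prop :=
  ∃ z : (P.complex.linearYonedaObj R M).cycles n,
    (P.complex.linearYonedaObj R M).homologyπ n z = (P.isoExt (R := R) n M).hom y ∧
    (P.complex.linearYonedaObj R M).iCycles n z = c

variable {X : ModuleCat.{0} R} (P : ProjectiveResolution X) (n : ℕ) (M : ModuleCat.{0} R)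

lemma rep_exists (y : ((Ext R (ModuleCat.{0} R) n).obj (op X)).obj M) : ∃ c, Rep P n M y c := by
  have : Function.Surjective ((P.complex.linearYonedaObj R M).homologyπ n) :=
    (ModuleCat.epi_iff_surjective _).1 inferInstance
  obtain ⟨z, hz⟩ := this ((P.isoExt (R := R) n M).hom y)
  exact ⟨_, z, hz, rfl⟩

lemma rep_closed {y} {c} (h : Rep P n M y c) : P.complex.d (n+1) n ≫ c = 0 := by
  obtain ⟨z, -, rfl⟩ := h
  have := (P.complex.linearYonedaObj R M).iCycles_d n (n+1)
  exact congrArg (fun f => f.hom z) this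

lemma rep_of_closed {c : P.complex.X n ⟶ M} (h : P.complex.d (n+1) n ≫ c = 0) :
    ∃ y, Rep P n M y c := by
  let L := P.complex.linearYonedaObj R M
  let k : ModuleCat.of R R ⟶ L.X n := ModuleCat.ofHom (LinearMap.toSpanSingleton R _ c)
  have hk : k ≫ L.d n (n+1) = 0 := by
    ext
    refine Eq.trans ?_ h
    change P.complex.d (n+1) n ≫ ((1:R) • c) = _
    rw [one_smul]
  refine ⟨(P.isoExt (R := R) n M).inv (L.homologyπ n (L.liftCycles k (n+1) (by simp) hk (1:R))), L.liftCycles k (n+1) (by simp) hk (1:R), ?_, ?_⟩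
  · simp [L]
  · have := congrArg (fun f => f.hom (1:R)) (L.liftCycles_i k (n+1) (by simp) hk)
    refine Eq.trans this ?_
    change (1:R) • c = c
    rw [one_smul]

lemma rep_smul {y} {c} (h : Rep P n M y c) (x : R) : Rep P n M (x • y) (x • c) := by
  obtain ⟨z, h1, rfl⟩ := h
  refine ⟨x • z, ?_, ?_⟩
  · simp [h1]
  · rw [map_smul]; rfl

lemma rep_zero {c} (h : Rep P n M 0 c) (m : ℕ) (hm : (ComplexShape.up ℕ).prev n = m) : ∃ g : P.complex.X m ⟶ M, c = P.complex.d n m ≫ g := by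
  obtain ⟨z, h1, rfl⟩ := h
  let L := P.complex.linearYonedaObj R M
  have ex := ShortComplex.exact_of_g_is_cokernel (ShortComplex.mk _ _ (L.toCycles_comp_homologyπ m n)) (L.homologyIsCokernel m n hm)
  rw [ShortComplex.moduleCat_exact_iff] at ex
  obtain ⟨g, hg⟩ := ex z (by simpa using h1)
  refine ⟨g, ?_⟩
  have := congrArg (fun f => f.hom g) (L.toCycles_i m n)
  rw [← hg]
  exact this

lemma rep_inj {y y'} {c} (h : Rep P n M y c) (h' : Rep P n M y' c) : y = y' := by
  obtain ⟨z, h1, rfl⟩ := h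
  obtain ⟨z', h1', h⟩ := h'
  have : Function.Injective ((P.complex.linearYonedaObj R M).iCycles n) :=
    (ModuleCat.mono_iff_injective _).1 inferInstance
  obtain rfl := this h
  have h2 := h1.symm.trans h1'
  have : Function.Injective (P.isoExt (R := R) n M).hom := 
    (ModuleCat.mono_iff_injective _).1 inferInstance
  exact this h2

lemma eq_zero_of_rep {y} (m : ℕ) (g : P.complex.X m ⟶ M) 
   (h : Rep P n M y (P.complex.d n m ≫ g)) : y = 0 := by
  refine rep_inj P n M h ?_
  let L := P.complex.linearYonedaObj R M
  refine ⟨L.toCycles m n g, ?_, ?_⟩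
  · have := congrArg (fun f => f.hom g) (L.toCycles_comp_homologyπ m n)
    simp only [map_zero]
    exact this
  · have := congrArg (fun f => f.hom g) (L.toCycles_i m n)
    exact this


lemma homologyUnop_nat {V ι : Type*} [Category V] [Abelian V] {c : ComplexShape ι}
    {K L : HomologicalComplex Vᵒᵖ c} (ψ : K ⟶ L) (n : ι) :
    (HomologicalComplex.homologyMap ψ n).unop ≫ (K.homologyUnop n).inv =
      (L.homologyUnop n).inv ≫
        HomologicalComplex.homologyMap ((HomologicalComplex.unopFunctor _ _).map ψ.op) n := by
  have e2 := HomologicalComplex.homologyOp_hom_naturality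
    ((HomologicalComplex.unopFunctor _ _).map ψ.op) n
  have e3 := congrArg Quiver.Hom.unop e2
  have h1 : (L.homologyUnop n).hom ≫ (HomologicalComplex.homologyMap ψ n).unop =
    HomologicalComplex.homologyMap ((HomologicalComplex.unopFunctor _ _).map ψ.op) n ≫
      (K.homologyUnop n).hom := e3
  exact (Iso.comp_inv_eq _).2 (((Iso.eq_inv_comp _).2 h1).trans (Category.assoc _ _ _).symm)

lemma rep_nat {X' : ModuleCat.{0} R} (P' : ProjectiveResolution X') (f : X' ⟶ X)
    (g : P'.complex ⟶ P.complex) (comm : g.f 0 ≫ P.π.f 0 = P'.π.f 0 ≫ f) {y} {c}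
    (h : Rep P n M y c) :
    Rep P' n M (((Ext R (ModuleCat.{0} R) n).map f.op).app M y) (g.f n ≫ c) := by
  obtain ⟨z, h1, rfl⟩ := h
  let F := ((linearYoneda R (ModuleCat.{0} R)).obj M).rightOp
  let φ : P.complex.linearYonedaObj R M ⟶ P'.complex.linearYonedaObj R M :=
    (HomologicalComplex.unopFunctor _ _).map ((F.mapHomologicalComplex _).map g).op
  have key : ((Ext R (ModuleCat.{0} R) n).map f.op).app M ≫ (P'.isoExt (R := R) n M).hom =
      (P.isoExt (R := R) n M).hom ≫ HomologicalComplex.homologyMap φ n := by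
    have e1 := P'.isoLeftDerivedObj_inv_naturality f P g comm F n
    have e3 := homologyUnop_nat ((F.mapHomologicalComplex _).map g) n
    have e4 := congrArg Quiver.Hom.unop e1
    refine (Category.assoc _ _ _).symm.trans ?_
    refine (congrArg (fun t => t ≫ (HomologicalComplex.homologyUnop ((F.mapHomologicalComplex _).obj P'.complex) n).inv) e4).trans ?_
    refine (Category.assoc _ _ _).trans ?_
    refine Eq.trans ?_ (Category.assoc _ _ _).symm
    exact congrArg (fun t => (P.isoLeftDerivedObj F n).inv.unop ≫ t) e3
  refine ⟨HomologicalComplex.cyclesMap φ n z, ?_, ?_⟩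
  · have e1 := congrArg (fun f => f.hom z) (HomologicalComplex.homologyπ_naturality φ n)
    refine Eq.trans e1.symm ?_
    refine Eq.trans (congrArg (HomologicalComplex.homologyMap φ n).hom h1) ?_
    exact (congrArg (fun f => f.hom y) key).symm
  · exact congrArg (fun f => f.hom z) (HomologicalComplex.cyclesMap_i φ n)
end ExtAux

namespace ExtAux
variable {R : Type} [CommRing R]

section
variable {X : ModuleCat.{0} R} (P : ProjectiveResolution X) 

/-- augmentation -/
def aug : P.complex.X 0 ⟶ X := P.π.f 0

lemma aug_surj : Function.Surjective (aug P) :=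
  (ModuleCat.epi_iff_surjective _).1 (inferInstanceAs (Epi (P.π.f 0)))

lemma d_aug : P.complex.d 1 0 ≫ aug P = 0 := P.complex_d_comp_π_f_zero

lemma d_aug_apply (q : P.complex.X 1) : aug P (P.complex.d 1 0 q) = 0 :=
  congrArg (fun f => f.hom q) (d_aug P)

lemma exact_aug (p : P.complex.X 0) (h : aug P p = 0) : ∃ q, P.complex.d 1 0 q = p := by
  have := P.exact₀
  rw [ShortComplex.moduleCat_exact_iff] at this
  exact this p h

lemma exact_one (p : P.complex.X 1) (h : P.complex.d 1 0 p = 0) : ∃ q, P.complex.d 2 1 q = p := by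
  have := P.exact_succ 0
  rw [ShortComplex.moduleCat_exact_iff] at this
  exact this p h

lemma smul_ext_eq_zero (n : ℕ) (M : ModuleCat.{0} R) (x : R) (hx : ∀ z : X, x • z = 0)
    (y : ((Ext R (ModuleCat.{0} R) n).obj (op X)).obj M) : x • y = 0 := by
  let P := projectiveResolution X
  obtain ⟨c, hc⟩ := rep_exists P n M y
  have h0 : x • (𝟙 X) = 0 := by
    ext z
    exact hx z
  have k1 : (x • 𝟙 (P.complex.X 0)) ≫ aug P = aug P ≫ (x • 𝟙 X) := by simp
  have k2 : (0 : P.complex.X 0 ⟶ _) ≫ aug P = aug P ≫ (x • 𝟙 X) := by simp [h0]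
  have h1 := rep_nat P n M P (x • 𝟙 X) (x • 𝟙 P.complex) k1 hc
  have h2 := rep_nat P n M P (x • 𝟙 X) 0 k2 hc
  have e1 : x • y = ((Ext R (ModuleCat.{0} R) n).map (x • 𝟙 X).op).app M y := by
    refine rep_inj P n M (rep_smul P n M hc x) ?_
    convert h1 using 1
    simp
  rw [e1]
  refine eq_zero_of_rep P n M n 0 ?_
  convert h2 using 1
  simp
end

section
variable {J : Ideal R} (P : ProjectiveResolution (ModuleCat.of R (R ⧸ J)))

lemma exists_lift_aug : ∃ h : P.complex.X 0 →ₗ[R] R, ∀ p, Ideal.Quotient.mk J (h p) = aug P p := by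
  let q : ModuleCat.of R R ⟶ ModuleCat.of R (R ⧸ J) := ModuleCat.ofHom (Submodule.mkQ J)
  have : Epi q := (ModuleCat.epi_iff_surjective _).2 (Submodule.mkQ_surjective J)
  refine ⟨(Projective.factorThru (aug P) q).hom, fun p => ?_⟩
  exact congrArg (fun f => f.hom p) (Projective.factorThru_comp (aug P) q)

lemma aug_smul (a : R) (p : P.complex.X 0) : aug P (a • p) = a • aug P p := map_smul (aug P).hom a p

lemma mem_aug (a : R) (ha : a ∈ J) (p : P.complex.X 0) : aug P (a • p) = 0 := by
  rw [aug_smul]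
  obtain ⟨r, hr⟩ := Ideal.Quotient.mk_surjective (aug P p)
  rw [← hr]
  exact (Ideal.Quotient.eq_zero_iff_mem.2 (J.mul_mem_right _ ha))

lemma ext_zero_iff (M : ModuleCat.{0} R) :
    Subsingleton (((Ext R (ModuleCat.{0} R) 0).obj (op (ModuleCat.of R (R ⧸ J)))).obj M) ↔
      ∀ m : M, (∀ j ∈ J, j • m = 0) → m = 0 := by
  let P := projectiveResolution (ModuleCat.of R (R ⧸ J))
  constructor
  · intro hs m hm
    let e : ModuleCat.of R (R ⧸ J) ⟶ M := ModuleCat.ofHom (Submodule.liftQ J (LinearMap.toSpanSingleton R M m)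
      (fun j hj => hm j hj))
    obtain ⟨y, hy⟩ := rep_of_closed P 0 M (c := aug P ≫ e) (by
      rw [← Category.assoc]; erw [d_aug]; simp)
    obtain rfl : y = 0 := Subsingleton.elim _ _
    obtain ⟨g, hg⟩ := rep_zero P 0 M hy 0 (by simp)
    have h0 : aug P ≫ e = 0 := by rw [hg]; simp
    obtain ⟨p, hp⟩ := aug_surj P (Ideal.Quotient.mk J 1)
    have := congrArg (fun f => f.hom p) h0
    have h2 : e (aug P p) = 0 := this
    rw [hp] at h2
    have h3 : (1:R) • m = 0 := h2
    simpa using h3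
  · intro h
    refine ⟨fun a b => ?_⟩
    suffices H : ∀ y : (((Ext R (ModuleCat.{0} R) 0).obj (op (ModuleCat.of R (R ⧸ J)))).obj M), y = 0 by
      rw [H a, H b]
    intro y
    obtain ⟨c, hc⟩ := rep_exists P 0 M y
    have h1 := rep_closed P 0 M hc
    have : c = P.complex.d 0 0 ≫ 0 := by
      ext p
      simp only [Limits.comp_zero]
      refine h _ fun j hj => ?_
      obtain ⟨q, hq⟩ := exact_aug P (j • p) (mem_aug P j hj p)
      have h3 := congrArg (fun f => f.hom q) h1
      have h4 : c (P.complex.d 1 0 q) = 0 := h3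
      rw [hq] at h4
      exact (map_smul c.hom j p).symm.trans h4
    rw [this] at hc
    exact eq_zero_of_rep P 0 M 0 0 hc

/-- the cocycle associated with `φ`. -/
def cocyc {J' : Ideal R} (P' : ProjectiveResolution (ModuleCat.of R (R ⧸ J')))
   (M : ModuleCat.{0} R) (φ : J →ₗ[R] M) (k : P'.complex.X 0 →ₗ[R] R)
    (hk : ∀ q, k (P'.complex.d 1 0 q) ∈ J) : P'.complex.X 1 ⟶ M :=
  ModuleCat.ofHom (φ ∘ₗ LinearMap.codRestrict J (k ∘ₗ (P'.complex.d 1 0).hom) hk)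

lemma cocyc_closed {J' : Ideal R} (P' : ProjectiveResolution (ModuleCat.of R (R ⧸ J')))
   (M : ModuleCat.{0} R) (φ : J →ₗ[R] M) (k : P'.complex.X 0 →ₗ[R] R)
    (hk : ∀ q, k (P'.complex.d 1 0 q) ∈ J) : P'.complex.d 2 1 ≫ cocyc P' M φ k hk = 0 := by
  ext p
  have h1 := congrArg (fun f => f.hom p) (P'.complex.d_comp_d 2 1 0)
  have h1' : P'.complex.d 1 0 (P'.complex.d 2 1 p) = 0 := h1
  change φ ⟨k (P'.complex.d 1 0 (P'.complex.d 2 1 p)), _⟩ = 0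
  convert map_zero φ
  rw [h1']; simp

lemma of_cocyc {J' : Ideal R} (P' : ProjectiveResolution (ModuleCat.of R (R ⧸ J'))) (hJ : J' ≤ J)
   (M : ModuleCat.{0} R) (φ : J →ₗ[R] M) (k : P'.complex.X 0 →ₗ[R] R)
    (hk : ∀ q, k (P'.complex.d 1 0 q) ∈ J)
    (hk' : ∀ p, Ideal.Quotient.mk J (k p) = Ideal.Quotient.factor hJ (aug P' p))
    (g : P'.complex.X 0 ⟶ M) (hg : cocyc P' M φ k hk = P'.complex.d 1 0 ≫ g) :
    ∃ b : M, ∀ j (hj : j ∈ J'), φ ⟨j, hJ hj⟩ = j • b := by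
  obtain ⟨p, hp⟩ := aug_surj P' (Ideal.Quotient.mk J' 1)
  have ht : k p - 1 ∈ J := by
    rw [← Ideal.Quotient.eq_zero_iff_mem, map_sub, hk', hp]; simp
  refine ⟨g p - φ ⟨k p - 1, ht⟩, fun j hj => ?_⟩
  obtain ⟨q, hq⟩ := exact_aug P' (j • p) (mem_aug P' j hj p)
  have h1 := congrArg (fun f => f.hom q) hg
  have h2 : φ ⟨k (P'.complex.d 1 0 q), hk q⟩ = g (P'.complex.d 1 0 q) := h1
  have h3 : g (P'.complex.d 1 0 q) = j • g p := by rw [hq]; exact map_smul g.hom j p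
  rw [h3] at h2
  rw [smul_sub, ← h2, ← map_smul, ← map_sub]
  congr 1
  ext
  simp [hq]
  ring

lemma ext_one_of (M : ModuleCat.{0} R)
    (h : ∀ φ : J →ₗ[R] M, ∃ b : M, ∀ j : J, φ j = (j : R) • b) :
    Subsingleton (((Ext R (ModuleCat.{0} R) 1).obj (op (ModuleCat.of R (R ⧸ J)))).obj M) := by
  let P := projectiveResolution (ModuleCat.of R (R ⧸ J))
  refine ⟨fun a b => ?_⟩
  suffices H : ∀ y : (((Ext R (ModuleCat.{0} R) 1).obj (op (ModuleCat.of R (R ⧸ J)))).obj M), y = 0 by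
    rw [H a, H b]
  intro y
  obtain ⟨c, hc⟩ := rep_exists P 1 M y
  have h1 := rep_closed P 1 M hc
  obtain ⟨h0, hh0⟩ := exists_lift_aug P
  obtain ⟨p0, hp0⟩ := aug_surj P (Ideal.Quotient.mk J 1)
  let d : P.complex.X 1 →ₗ[R] P.complex.X 0 := (P.complex.d 1 0).hom
  have hker : LinearMap.ker d ≤ LinearMap.ker c.hom := by
    intro p hp
    obtain ⟨q, rfl⟩ := exact_one P p hp
    exact congrArg (fun f => f.hom q) h1
  let cb : LinearMap.range d →ₗ[R] M :=
    (LinearMap.ker d).liftQ c.hom hker ∘ₗ (d.quotKerEquivRange.symm : _ →ₗ[R] _)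
  have hcb : ∀ q hq, cb ⟨d q, hq⟩ = c q := by
    intro q hq
    have : d.quotKerEquivRange.symm ⟨d q, hq⟩ = Submodule.Quotient.mk q := by
      rw [LinearEquiv.symm_apply_eq]; rfl
    simp only [cb, LinearMap.comp_apply, LinearEquiv.coe_coe, this]
    rfl
  have hr : ∀ p, aug P p = 0 → p ∈ LinearMap.range d := fun p hp => exact_aug P p hp
  let μ : J →ₗ[R] LinearMap.range d := LinearMap.codRestrict _
    ((LinearMap.toSpanSingleton R _ p0) ∘ₗ J.subtype) (fun j => hr _ (mem_aug P j j.2 p0))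
  obtain ⟨b, hb⟩ := h (cb ∘ₗ μ)
  have h5 : ∀ p, p - h0 p • p0 ∈ LinearMap.range d := by
    intro p
    refine hr _ ?_
    have e1 : aug P (p - h0 p • p0) = aug P p - aug P (h0 p • p0) := map_sub (aug P).hom _ _
    rw [e1, aug_smul, hp0, ← hh0 p]
    have : (h0 p • Ideal.Quotient.mk J 1) = Ideal.Quotient.mk J (h0 p) := by
      rw [← Ideal.Quotient.mk_eq_mk, ← Submodule.Quotient.mk_smul]; simp
    exact sub_eq_zero.2 this.symm
  let ν : P.complex.X 0 →ₗ[R] LinearMap.range d := LinearMap.codRestrict _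
    (LinearMap.id - (LinearMap.toSpanSingleton R _ p0) ∘ₗ h0) h5
  let g : P.complex.X 0 ⟶ M := ModuleCat.ofHom (LinearMap.toSpanSingleton R _ b ∘ₗ h0 + cb ∘ₗ ν)
  have : c = P.complex.d 1 0 ≫ g := by
    ext q
    have hj : h0 (d q) ∈ J := by
      rw [← Ideal.Quotient.eq_zero_iff_mem, hh0]; exact d_aug_apply P q
    have hb' := hb ⟨h0 (d q), hj⟩
    change c q = h0 (d q) • b + cb (ν (d q))
    have hb2 : cb (μ ⟨h0 (d q), hj⟩) = h0 (d q) • b := hb'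
    rw [← hb2, ← hcb q (LinearMap.mem_range_self d q)]
    refine Eq.trans (congrArg cb ?_) (map_add cb _ _)
    refine Subtype.ext ?_
    change d q = h0 (d q) • p0 + (d q - h0 (d q) • p0)
    abel
  rw [this] at hc
  exact eq_zero_of_rep P 1 M 0 g hc

lemma of_ext_one (M : ModuleCat.{0} R) 
    (hs : Subsingleton (((Ext R (ModuleCat.{0} R) 1).obj (op (ModuleCat.of R (R ⧸ J)))).obj M)) 
    (φ : J →ₗ[R] M) : ∃ b : M, ∀ j : J, φ j = (j : R) • b := by
  let P := projectiveResolution (ModuleCat.of R (R ⧸ J))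
  obtain ⟨h0, hh0⟩ := exists_lift_aug P
  have hk : ∀ q, h0 (P.complex.d 1 0 q) ∈ J := fun q => by
    rw [← Ideal.Quotient.eq_zero_iff_mem, hh0]; exact d_aug_apply P q
  obtain ⟨y, hy⟩ := rep_of_closed P 1 M (cocyc_closed P M φ h0 hk)
  obtain rfl : y = 0 := Subsingleton.elim _ _
  obtain ⟨g, hg⟩ := rep_zero P 1 M hy 0 (by simp)
  obtain ⟨b, hb⟩ := of_cocyc P le_rfl M φ h0 hk (fun p => by
    rw [hh0]; obtain ⟨r, hr⟩ := Ideal.Quotient.mk_surjective (aug P p); rw [← hr]; simp) g hg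
  exact ⟨b, fun j => hb j j.2⟩

end

lemma ext_zero_one_of_regular {J : Ideal R} (M : ModuleCat.{0} R) (f g : R) (hf : f ∈ J) (hg : g ∈ J)
    (h1 : ∀ m : M, f • m = 0 → m = 0) (h2 : ∀ m m' : M, g • m = f • m' → ∃ m'', m = f • m'') : 
    Subsingleton (((Ext R (ModuleCat.{0} R) 1).obj (op (ModuleCat.of R (R ⧸ J)))).obj M) := by
  refine ext_one_of M fun φ => ?_
  have comm : ∀ a b : J, (a : R) • φ b = (b : R) • φ a := by
    intro a b
    rw [← map_smul, ← map_smul]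
    congr 1
    ext
    simp [mul_comm]
  obtain ⟨b, hb⟩ := h2 (φ ⟨f, hf⟩) (φ ⟨g, hg⟩) (comm ⟨g, hg⟩ ⟨f, hf⟩)
  refine ⟨b, fun j => ?_⟩
  rw [← sub_eq_zero]
  apply h1
  rw [smul_sub, comm ⟨f, hf⟩ j, hb, sub_eq_zero, smul_comm]

end ExtAux

namespace ExtAux
variable {R : Type} [CommRing R]

lemma lc_exists_rep (J : Ideal R) (i : ℕ) (M : ModuleCat.{0} R)
   (y : (localCohomology J i).obj M) : 
    letI := localCohomology.hasColimitDiagram (localCohomology.idealPowersDiagram J) i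
    ∃ (k : ℕ) (y' : ((localCohomology.diagram (localCohomology.idealPowersDiagram J) i).obj (op (op k))).obj M),
      y = (Limits.colimit.ι (localCohomology.diagram (localCohomology.idealPowersDiagram J) i)
          (op (op k))).app M y' := by
  have := localCohomology.hasColimitDiagram (localCohomology.idealPowersDiagram J) i
  let D := localCohomology.diagram (localCohomology.idealPowersDiagram J) i
  let hc := Limits.isColimitOfPreserves ((evaluation _ _).obj M) (Limits.colimit.isColimit D)
  obtain ⟨j, y', h⟩ := Limits.Concrete.isColimit_exists_rep _ hc y
  exact ⟨j.unop.unop, y', h.symm⟩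

lemma lc_rep_zero (J : Ideal R) (i : ℕ) (M : ModuleCat.{0} R) (k : ℕ)
   (y : ((localCohomology.diagram (localCohomology.idealPowersDiagram J) i).obj (op (op k))).obj M)
   (hy : letI := localCohomology.hasColimitDiagram (localCohomology.idealPowersDiagram J) i
      (Limits.colimit.ι (localCohomology.diagram (localCohomology.idealPowersDiagram J) i)
          (op (op k))).app M y = 0) :
     ∃ (k' : ℕ) (h : k ≤ k'), 
       ((localCohomology.diagram (localCohomology.idealPowersDiagram J) i).map
         ((homOfLE h).op.op)).app M y = 0 := by
  have := localCohomology.hasColimitDiagram (localCohomology.idealPowersDiagram J) i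
  let D := localCohomology.diagram (localCohomology.idealPowersDiagram J) i
  let hc := Limits.isColimitOfPreserves ((evaluation _ _).obj M) (Limits.colimit.isColimit D)
  obtain ⟨j, f, g, h⟩ := Limits.Concrete.isColimit_exists_of_rep_eq _ hc y 
    (0 : ((localCohomology.diagram (localCohomology.idealPowersDiagram J) i).obj (op (op k))).obj M) (by
      refine Eq.trans hy ?_
      exact (map_zero _).symm)
  refine ⟨j.unop.unop, leOfHom f.unop.unop, ?_⟩
  refine Eq.trans h (map_zero _)

lemma lc_kill (J : Ideal R) (i : ℕ) (M : ModuleCat.{0} R) 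
    (hs : letI := localCohomology.hasColimitDiagram (localCohomology.idealPowersDiagram J) i;
      Function.Surjective ((Limits.colimit.ι (localCohomology.diagram (localCohomology.idealPowersDiagram J) i)
          (op (op 1))).app M)) (x : R) (hx : x ∈ J) (y : (localCohomology J i).obj M) : x • y = 0 := by
  have := localCohomology.hasColimitDiagram (localCohomology.idealPowersDiagram J) i
  obtain ⟨y', rfl⟩ := hs y
  have h0 : x • y' = 0 := smul_ext_eq_zero (X := ModuleCat.of R (R ⧸ J ^ 1)) i M x (by
    intro z
    obtain ⟨r, rfl⟩ := Ideal.Quotient.mk_surjective z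
    exact (Ideal.Quotient.eq_zero_iff_mem.2 (Ideal.mul_mem_right _ _ (by simpa using hx)))) y'
  have h1 := congrArg ((Limits.colimit.ι (localCohomology.diagram (localCohomology.idealPowersDiagram J) i)
          (op (op 1))).app M).hom h0
  rw [map_smul, map_zero] at h1
  exact h1

lemma lc_surj (J : Ideal R) (i : ℕ) (M : ModuleCat.{0} R) 
    (h : ∀ k, Subsingleton (((Ext R (ModuleCat.{0} R) i).obj (op (ModuleCat.of R (R ⧸ J ^ k)))).obj M)) :
    letI := localCohomology.hasColimitDiagram (localCohomology.idealPowersDiagram J) i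
    Function.Surjective ((Limits.colimit.ι (localCohomology.diagram (localCohomology.idealPowersDiagram J) i)
          (op (op 1))).app M) := by
  have := localCohomology.hasColimitDiagram (localCohomology.idealPowersDiagram J) i
  intro y
  obtain ⟨k, y', rfl⟩ := lc_exists_rep J i M y
  refine ⟨0, ?_⟩
  have : y' = 0 := (h k).elim _ _
  rw [this, map_zero, map_zero]

lemma lc_Q (J : Ideal R) (M : ModuleCat.{0} R) (x : R) (hx : ∀ y : (localCohomology J 1).obj M, x • y = 0)
    (l : ℕ) (φ : ↥(J ^ l) →ₗ[R] M) :
    ∃ (l' : ℕ) (h : l ≤ l') (b : M), ∀ j (hj : j ∈ J ^ l'), 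
      x • φ ⟨j, Ideal.pow_le_pow_right h hj⟩ = j • b := by
  have := localCohomology.hasColimitDiagram (localCohomology.idealPowersDiagram J) 1
  let P := projectiveResolution (ModuleCat.of R (R ⧸ J ^ l))
  obtain ⟨h0, hh0⟩ := exists_lift_aug P
  have hk : ∀ q, h0 (P.complex.d 1 0 q) ∈ J ^ l := fun q => by
    rw [← Ideal.Quotient.eq_zero_iff_mem, hh0]; exact d_aug_apply P q
  obtain ⟨y, hy⟩ := rep_of_closed P 1 M (cocyc_closed P M φ h0 hk)
  have h1 := hx ((Limits.colimit.ι (localCohomology.diagram (localCohomology.idealPowersDiagram J) 1)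
          (op (op l))).app M y)
  obtain ⟨l', hl, h2⟩ := lc_rep_zero J 1 M l (x • y) (by
    refine Eq.trans ?_ h1
    exact map_smul ((Limits.colimit.ι (localCohomology.diagram (localCohomology.idealPowersDiagram J) 1)
          (op (op l))).app M).hom x y)
  have hJ : J ^ l' ≤ J ^ l := Ideal.pow_le_pow_right hl
  let P' := projectiveResolution (ModuleCat.of R (R ⧸ J ^ l'))
  let f : ModuleCat.of R (R ⧸ J ^ l') ⟶ ModuleCat.of R (R ⧸ J ^ l) := 
    ModuleCat.ofHom <| Submodule.mapQ _ _ LinearMap.id hJ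
  let g : P'.complex ⟶ P.complex := ProjectiveResolution.lift f P' P
  have comm : g.f 0 ≫ P.π.f 0 = P'.π.f 0 ≫ f := ProjectiveResolution.lift_commutes_zero f P' P
  have h3 := rep_nat P 1 M P' f g comm (rep_smul P 1 M hy x)
  have h4 : (((Ext R (ModuleCat.{0} R) 1).map f.op).app M) (x • y) = 0 := h2
  rw [h4] at h3
  obtain ⟨g', hg'⟩ := rep_zero P' 1 M h3 0 (by simp)
  let k : P'.complex.X 0 →ₗ[R] R := h0 ∘ₗ (g.f 0).hom
  have hgd : ∀ q, g.f 0 (P'.complex.d 1 0 q) = P.complex.d 1 0 (g.f 1 q) := by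
    intro q
    exact (congrArg (fun f => f.hom q) (g.comm 1 0)).symm
  have hkq : ∀ q, k (P'.complex.d 1 0 q) = h0 (P.complex.d 1 0 (g.f 1 q)) := by
    intro q
    exact congrArg h0 (hgd q)
  have hk2 : ∀ q, k (P'.complex.d 1 0 q) ∈ J ^ l := by
    intro q
    rw [hkq]; exact hk _
  obtain ⟨b, hb⟩ := of_cocyc P' hJ M (x • φ) k hk2 (by
    intro p
    refine (hh0 (g.f 0 p)).trans ?_
    have h5 : aug P (g.f 0 p) = f (aug P' p) := congrArg (fun f => f.hom p) comm
    rw [h5]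
    obtain ⟨r, hr⟩ := Ideal.Quotient.mk_surjective (aug P' p)
    rw [← hr]
    rfl) g' (by
      rw [← hg']
      ext q
      change x • φ ⟨k (P'.complex.d 1 0 q), _⟩ = x • φ ⟨h0 (P.complex.d 1 0 (g.f 1 q)), _⟩
      congr 3
      exact hkq q)
  exact ⟨l', hl, b, fun j hj => hb j hj⟩
end ExtAux

namespace GraphAux
open MvPolynomial
variable {K : Type} [Field K] {n : ℕ}

/-- indicator exponent -/
noncomputable def ind (F : Finset (Fin n)) : Fin n →₀ ℕ := ∑ i ∈ F, Finsupp.single i 1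

lemma ind_apply (F : Finset (Fin n)) (k : Fin n) : ind F k = if k ∈ F then 1 else 0 := by
  simp [ind, Finsupp.finsetSum_apply, Finsupp.single_apply]

/-- exponents of the generators of the powers -/
def Gm (Δ : SimComplex n) : ℕ → Set (Fin n →₀ ℕ)
  | 0 => {0}
  | m+1 => {g | ∃ F, F ∉ Δ.faces ∧ ∃ g' ∈ Gm Δ m, g = ind F + g'}

lemma faceMonomial_eq (F : Finset (Fin n)) : faceMonomial K F = monomial (ind F) 1 := by
  rw [faceMonomial, ind, monomial_sum_one]
  rfl

lemma SR_pow_eq (Δ : SimComplex n) (m : ℕ) : SRIdeal K Δ ^ m =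
    Ideal.span ((fun s => monomial s (1:K)) '' Gm Δ m) := by
  induction m with
  | zero =>
    simp only [Gm, pow_zero, Set.image_singleton]
    have : (monomial (0 : Fin n →₀ ℕ)) (1:K) = 1 := rfl
    rw [this]; simp
  | succ m ih =>
    rw [pow_succ', ih, SRIdeal, Ideal.span_mul_span']
    congr 1
    ext p
    simp only [Set.mem_mul, Set.mem_ofPred_eq, Set.mem_image, Gm]
    constructor
    · rintro ⟨_, ⟨F, hF, rfl⟩, _, ⟨g, hg, rfl⟩, rfl⟩
      exact ⟨_, ⟨F, hF, g, hg, rfl⟩, by rw [faceMonomial_eq, monomial_mul, one_mul]⟩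
    · rintro ⟨_, ⟨F, hF, g, hg, rfl⟩, rfl⟩
      exact ⟨_, ⟨F, hF, rfl⟩, _, ⟨g, hg, rfl⟩, by rw [faceMonomial_eq, monomial_mul, one_mul]⟩

lemma mem_SR_pow (Δ : SimComplex n) (m : ℕ) (p : MvPolynomial (Fin n) K) :
    p ∈ SRIdeal K Δ ^ m ↔ ∀ γ ∈ p.support, ∃ g ∈ Gm Δ m, g ≤ γ := by
  rw [SR_pow_eq, mem_ideal_span_monomial_image]

lemma monomial_mem (Δ : SimComplex n) (m : ℕ) (γ : Fin n →₀ ℕ) :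
    monomial γ (1:K) ∈ SRIdeal K Δ ^ m ↔ ∃ g ∈ Gm Δ m, g ≤ γ := by
  classical
  rw [mem_SR_pow]; simp [support_monomial]

lemma coeff_eq_zero {Δ : SimComplex n} {m : ℕ} {p : MvPolynomial (Fin n) K}
    (hp : p ∈ SRIdeal K Δ ^ m) {γ : Fin n →₀ ℕ} (hγ : ¬ ∃ g ∈ Gm Δ m, g ≤ γ) : coeff γ p = 0 := by
  by_contra h
  exact hγ ((mem_SR_pow Δ m p).1 hp γ (mem_support_iff.2 h))

lemma Gm_mono {Δ : SimComplex n} {m : ℕ} {γ δ : Fin n →₀ ℕ} (h : γ ≤ δ) (h1 : ∃ g ∈ Gm Δ m, g ≤ γ) :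
    ∃ g ∈ Gm Δ m, g ≤ δ := by
  obtain ⟨g, hg, hle⟩ := h1
  exact ⟨g, hg, hle.trans h⟩

lemma Gm_weight {Δ : SimComplex n} (w : Fin n → ℕ) (c : ℕ)
    (hw : ∀ F, F ∉ Δ.faces → c ≤ ∑ i ∈ F, w i) {m : ℕ} {γ : Fin n →₀ ℕ}
    (h : ∃ g ∈ Gm Δ m, g ≤ γ) : c * m ≤ ∑ i, w i * γ i := by
  obtain ⟨g, hg, hle⟩ := h
  have h1 : c * m ≤ ∑ i, w i * g i := by
    clear hle
    induction m generalizing g with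
    | zero => simp
    | succ m ih =>
      obtain ⟨F, hF, g', hg', rfl⟩ := hg
      have := ih g' hg'
      have h2 := hw F hF
      simp only [Finsupp.add_apply, mul_add, Finset.sum_add_distrib, ind_apply]
      simp
      omega
  refine h1.trans (Finset.sum_le_sum fun i _ => Nat.mul_le_mul_left _ (hle i))

/-- test at an edge -/
lemma Gm_edge {Δ : SimComplex n} {i j : Fin n} (hij : {i,j} ∈ Δ.faces)
    {m : ℕ} {γ : Fin n →₀ ℕ} (h : ∃ g ∈ Gm Δ m, g ≤ γ) :
    m ≤ ∑ k, if k = i ∨ k = j then 0 else γ k := by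
  have := Gm_weight (fun k => if k = i ∨ k = j then 0 else 1) 1 (fun F hF => ?_) h
  · simpa [ite_mul] using this
  · by_contra hlt
    have h0 : ∑ x ∈ F, (if x = i ∨ x = j then 0 else 1) = 0 := by omega
    rw [Finset.sum_eq_zero_iff] at h0
    refine hF (Δ.down_closed hij fun x hx => ?_)
    have := h0 x hx
    simp at this
    simpa [or_iff_not_imp_left] using this

lemma Gm_pair {Δ : SimComplex n} {i j : Fin n} (hne : i ≠ j) (hij : {i,j} ∉ Δ.faces) (m : ℕ)
    {γ : Fin n →₀ ℕ} (hi : m ≤ γ i) (hj : m ≤ γ j) : ∃ g ∈ Gm Δ m, g ≤ γ := by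
  refine ⟨m • ind {i,j}, ?_, ?_⟩
  · clear hi hj
    induction m with
    | zero => simp [Gm]
    | succ m ih => exact ⟨_, hij, _, ih, by rw [succ_nsmul']⟩
  · intro k
    simp [ind_apply]
    split_ifs with h
    · rcases h with rfl | rfl <;> omega
    · simp

lemma Gm_triple {Δ : SimComplex n} (hgraph : ∀ F ∈ Δ.faces, F.card ≤ 2) {i j : Fin n} (hne : i ≠ j)
    (m : ℕ) {γ : Fin n →₀ ℕ} (hi : m ≤ γ i) (hj : m ≤ γ j)
    (hs : m ≤ ∑ k, if k = i ∨ k = j then 0 else γ k) : ∃ g ∈ Gm Δ m, g ≤ γ := by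
  induction m generalizing γ with
  | zero => exact ⟨0, by simp [Gm], by simp⟩
  | succ m ih =>
    have : ∃ k, ¬ (k = i ∨ k = j) ∧ 0 < γ k := by
      by_contra! hcon
      have : ∑ k, (if k = i ∨ k = j then 0 else γ k) = 0 := by
        refine Finset.sum_eq_zero fun k _ => ?_
        split_ifs with hk
        · rfl
        · have := hcon k (by tauto); omega
      omega
    obtain ⟨k, hk, hpos⟩ := this
    push Not at hk
    have hle : ind {i,j,k} ≤ γ := by
      intro x
      simp only [ind_apply]
      split_ifs with hx
      · simp at hx; rcases hx with rfl | rfl | rfl <;> omega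
      · simp
    obtain ⟨g, hg, hgle⟩ := ih (γ := γ - ind {i,j,k}) (by simp [ind_apply]; omega) 
       (by simp [ind_apply]; omega) (by
        have : ∑ x, (if x = i ∨ x = j then 0 else γ x) =
           (∑ x, (if x = i ∨ x = j then 0 else (γ - ind {i,j,k}) x)) + 1 := by
          rw [← Finset.sum_erase_add _ _ (Finset.mem_univ k), ← Finset.sum_erase_add (a := k) _ 
             (fun x => (if x = i ∨ x = j then 0 else (γ - ind {i,j,k}) x)) (Finset.mem_univ k)]
          have e1 : ∑ x ∈ Finset.univ.erase k, (if x = i ∨ x = j then 0 else γ x) = 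
             ∑ x ∈ Finset.univ.erase k, (if x = i ∨ x = j then 0 else (γ - ind {i,j,k}) x) := by
            refine Finset.sum_congr rfl fun x hx => ?_
            have := Finset.ne_of_mem_erase hx
            split_ifs with h
            · rfl
            · push Not at h
              simp [ind_apply, h.1, h.2, this]
          rw [e1]
          simp [ind_apply, hk.1, hk.2]
          omega
        omega)
    refine ⟨ind {i,j,k} + g, ⟨_, fun h => ?_, g, hg, rfl⟩, ?_⟩
    · have := hgraph _ h
      rw [Finset.card_eq_three.2 ⟨i, j, k, hne, hk.1.symm, hk.2.symm, rfl⟩] at this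
      omega
    · intro x
      have h1 := hgle x
      have h2 := hle x
      simp only [Finsupp.add_apply, Finsupp.tsub_apply] at *
      omega
end GraphAux

namespace GraphAux
open MvPolynomial
variable {K : Type} [Field K] {n : ℕ}

lemma maxIdeal_eq : maxIdeal K n = idealOfVars (Fin n) K := rfl

lemma X_pow_mem {l L : ℕ} (h : l ≤ L) (i : Fin n) :
    (X i ^ L : MvPolynomial (Fin n) K) ∈ maxIdeal K n ^ l :=
  Ideal.pow_le_pow_right h (Ideal.pow_mem_pow (Ideal.subset_span (Set.mem_range_self i)) L)

/-- The key property -/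
def PropQ (I : Ideal (MvPolynomial (Fin n) K)) : Prop :=
  ∀ (l : ℕ) (φ : ↥(maxIdeal K n ^ l) →ₗ[MvPolynomial (Fin n) K] (MvPolynomial (Fin n) K ⧸ I))
    (k : Fin n), ∃ (s f : MvPolynomial (Fin n) K) (L : ℕ) (h : l ≤ L), coeff 0 s ≠ 0 ∧
      ∀ i, (s * X k) • φ ⟨X i ^ L, X_pow_mem h i⟩ = Ideal.Quotient.mk I (f * X i ^ L)

lemma exists_map (I : Ideal (MvPolynomial (Fin n) K)) (l : ℕ)
    (Φ : (Fin n →₀ ℕ) → MvPolynomial (Fin n) K ⧸ I)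
    (hΦ : ∀ γ, l ≤ γ.degree → ∀ i, Φ (γ + Finsupp.single i 1) = (X i : MvPolynomial (Fin n) K) • Φ γ) :
    ∃ φ : ↥(maxIdeal K n ^ l) →ₗ[MvPolynomial (Fin n) K] (MvPolynomial (Fin n) K ⧸ I),
      ∀ γ (h : monomial γ 1 ∈ maxIdeal K n ^ l), φ ⟨monomial γ 1, h⟩ = Φ γ := by
  let Ψ : MvPolynomial (Fin n) K →ₗ[K] (MvPolynomial (Fin n) K ⧸ I) :=
    (basisMonomials (Fin n) K).constr K Φ
  have hΨ : ∀ γ, Ψ (monomial γ 1) = Φ γ := by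
    intro γ
    have := (basisMonomials (Fin n) K).constr_basis K Φ γ
    rwa [coe_basisMonomials] at this
  have h1 : ∀ p ∈ maxIdeal K n ^ l, ∀ i, Ψ (X i * p) = (X i : MvPolynomial (Fin n) K) • Ψ p := by
    intro p hp i
    rw [maxIdeal_eq, mem_pow_idealOfVars_iff] at hp
    rw [p.as_sum, Finset.mul_sum, map_sum, map_sum, Finset.smul_sum]
    refine Finset.sum_congr rfl fun γ hγ => ?_
    have e1 : monomial γ (coeff γ p) = (coeff γ p) • monomial γ (1:K) := by
      rw [smul_monomial]; simp
    rw [e1, mul_smul_comm, map_smul, map_smul, hΨ, smul_comm, ← hΦ γ (hp γ hγ), ← hΨ]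
    congr 2
    rw [X, monomial_mul, add_comm]; simp
  have h2 : ∀ q p, p ∈ maxIdeal K n ^ l → Ψ (q * p) = q • Ψ p := by
    intro q
    induction q using MvPolynomial.induction_on with
    | C a => 
      intro p hp
      rw [C_mul', map_smul, algebra_compatible_smul (MvPolynomial (Fin n) K)]; rfl
    | add q q' h h' => intro p hp; rw [add_mul, map_add, h p hp, h' p hp, add_smul]
    | mul_X q i h => 
      intro p hp
      rw [mul_assoc, h _ (Ideal.mul_mem_left _ _ hp), h1 p hp, mul_smul]
  exact ⟨{ toFun := fun p => Ψ p.1, map_add' := fun a b => by simp, 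
           map_smul' := fun q p => h2 q p.1 p.2 }, fun γ _ => hΨ γ⟩

lemma exists_large {γ : Fin n →₀ ℕ} {N : ℕ} (h : n * N < γ.degree) : ∃ j, N ≤ γ j := by
  by_contra! hcon
  have : γ.degree ≤ n * N := by
    rw [Finsupp.degree_eq_sum]
    refine (Finset.sum_le_sum (g := fun _ => N) fun i _ => (hcon i).le).trans ?_
    simp
  omega

lemma monomial_single_pow (i : Fin n) (L : ℕ) : 
   (X i ^ L : MvPolynomial (Fin n) K) = monomial (Finsupp.single i L) 1 := X_pow_eq_monomial ..

lemma caseA {Δ : SimComplex n} {m : ℕ} (hQ : PropQ (SRIdeal K Δ ^ m)) (T : Set (Fin n)) (α : Fin n →₀ ℕ)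
    (N : ℕ) (hN : ∀ i ∈ T, ∀ j, j ∉ T → ∃ g ∈ Gm Δ m, g ≤ α + Finsupp.single i N + Finsupp.single j N)
    (k i j : Fin n) (hi : i ∈ T) (hj : j ∉ T)
    (h1 : ∀ L, ¬ ∃ g ∈ Gm Δ m, g ≤ α + Finsupp.single k 1 + Finsupp.single i L)
    (h2 : ∀ L, ¬ ∃ g ∈ Gm Δ m, g ≤ α + Finsupp.single k 1 + Finsupp.single j L) : False := by
  classical
  let I := SRIdeal K Δ ^ m
  let Φ : (Fin n →₀ ℕ) → MvPolynomial (Fin n) K ⧸ I := fun γ =>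
    if ∃ i ∈ T, N ≤ γ i then Ideal.Quotient.mk I (monomial (α + γ) 1) else 0
  obtain ⟨φ, hφ⟩ := exists_map I (n * N + N + 1) Φ (by
    intro γ hγ i
    obtain ⟨j, hj⟩ := exists_large (γ := γ) (N := N) (by omega)
    simp only [Φ]
    by_cases hc : ∃ i ∈ T, N ≤ γ i
    · have hc' : ∃ i' ∈ T, N ≤ (γ + Finsupp.single i 1 : Fin n →₀ ℕ) i' := by
        obtain ⟨i', h, h'⟩ := hc
        exact ⟨i', h, by simp; omega⟩
      rw [if_pos hc, if_pos hc']
      change _ = Ideal.Quotient.mk I (X i * _)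
      rw [X, monomial_mul]
      congr 2
      · congr 1; rw [← add_assoc, add_comm]
      · rw [one_mul]
    · rw [if_neg hc, smul_zero]
      split_ifs with hc'
      · obtain ⟨i', hi', h'⟩ := hc'
        push Not at hc
        have hjT : j ∉ T := fun h => by have := hc j h; omega
        have e : i' = i := by
          by_contra hne
          have := hc i' hi'
          simp [Finsupp.single_apply, Ne.symm hne] at h'
          omega
        subst e
        refine Ideal.Quotient.eq_zero_iff_mem.2 ((monomial_mem ..).2 (Gm_mono ?_ (hN i' hi' j hjT)))
        have hij : i' ≠ j := fun h => hjT (h ▸ hi')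
        intro x
        simp only [Finsupp.add_apply, Finsupp.single_apply] at h' ⊢
        split_ifs with ha hb <;> simp_all
      · rfl)
  obtain ⟨s, f, L, hL, hs, H⟩ := hQ _ φ k
  have hLN : N ≤ L := by omega
  have hi' := H i
  have hj' := H j
  have e : ∀ i, φ ⟨X i ^ L, X_pow_mem hL i⟩ = Φ (Finsupp.single i L) := by
    intro i
    have h := X_pow_mem (K := K) hL i
    rw [monomial_single_pow] at h
    rw [← hφ _ h]
    congr 2
    exact monomial_single_pow i L
  rw [e] at hi' hj'
  have c1 : Φ (Finsupp.single i L) = Ideal.Quotient.mk I (monomial (α + Finsupp.single i L) 1) :=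
    if_pos ⟨i, hi, by simpa using hLN⟩
  have c2 : Φ (Finsupp.single j L) = 0 := by
    refine if_neg ?_
    rintro ⟨x, hx, hx'⟩
    have : j ≠ x := fun h => hj (h ▸ hx)
    simp [Finsupp.single_apply, this] at hx'
    subst hx'
    have := h1 0
    have h3 := hN i hi j hj
    apply this
    refine Gm_mono ?_ h3
    simp
  rw [c1] at hi'
  rw [c2, smul_zero] at hj'
  have hi2 : s * X k * monomial (α + Finsupp.single i L) 1 - f * X i ^ L ∈ I := by
    rw [← Ideal.Quotient.eq_zero_iff_mem, map_sub, sub_eq_zero]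
    exact hi'
  have hj2 : f * X j ^ L ∈ I := Ideal.Quotient.eq_zero_iff_mem.1 hj'.symm
  have k1 := coeff_eq_zero hi2 (h1 L)
  have k2 := coeff_eq_zero hj2 (h2 L)
  rw [monomial_single_pow, coeff_mul_monomial] at k2
  rw [coeff_sub, monomial_single_pow, coeff_mul_monomial] at k1
  have e3 : s * X k * monomial (α + Finsupp.single i L) 1 = s * monomial (α + Finsupp.single k 1 + Finsupp.single i L) 1 := by
    rw [mul_assoc, X, monomial_mul]
    congr 2
    · congr 1; abel
    · simp
  have e4 := coeff_mul_monomial (0 : Fin n →₀ ℕ) (α + Finsupp.single k 1 + Finsupp.single i L) (1:K) s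
  rw [zero_add] at e4
  rw [e3, e4] at k1
  simp only [mul_one] at k1 k2
  rw [k2, sub_zero] at k1
  exact hs k1

lemma caseB {Δ : SimComplex n} {m : ℕ} (hQ : PropQ (SRIdeal K Δ ^ m)) (i : Fin n) (α : Fin n →₀ ℕ)
    (hα : α i = 0)
    (N : ℕ) (hN : ∀ j, j ≠ i → ∃ g ∈ Gm Δ m, g ≤ α + Finsupp.single i N + Finsupp.single j N)
    (h1 : ∀ L, ¬ ∃ g ∈ Gm Δ m, g ≤ α + Finsupp.single i L) : False := by
  classical
  let I := SRIdeal K Δ ^ m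
  let Φ : (Fin n →₀ ℕ) → MvPolynomial (Fin n) K ⧸ I := fun γ =>
    if N + 2 ≤ γ i then Ideal.Quotient.mk I (monomial (α + (γ - Finsupp.single i 2)) 1) else 0
  obtain ⟨φ, hφ⟩ := exists_map I (n * (N + 2) + (N + 2) + 1) Φ (by
    intro γ hγ k
    obtain ⟨j, hj⟩ := exists_large (γ := γ) (N := N + 2) (by omega)
    simp only [Φ]
    by_cases hc : N + 2 ≤ γ i
    · have hc' : N + 2 ≤ (γ + Finsupp.single k 1 : Fin n →₀ ℕ) i := by
        simp; omega
      rw [if_pos hc, if_pos hc']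
      change _ = Ideal.Quotient.mk I (X k * _)
      rw [X, monomial_mul]
      congr 2
      · congr 1
        ext x
        simp only [Finsupp.add_apply, Finsupp.tsub_apply, Finsupp.single_apply]
        split_ifs <;> simp_all <;> omega
      · simp
    · rw [if_neg hc, smul_zero]
      split_ifs with hc'
      · have e : k = i := by
          by_contra hne
          simp [Finsupp.single_apply, hne] at hc'
          omega
        subst e
        have hjT : j ≠ k := fun h => by subst h; omega
        refine Ideal.Quotient.eq_zero_iff_mem.2 ((monomial_mem ..).2 (Gm_mono ?_ (hN j hjT)))
        intro x
        simp only [Finsupp.add_apply, Finsupp.tsub_apply, Finsupp.single_apply] at hc' ⊢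
        split_ifs with ha hb <;> simp_all
        · omega
        · omega
      · rfl)
  obtain ⟨s, f, L, hL, hs, H⟩ := hQ _ φ i
  have hLN : N + 2 ≤ L := by omega
  have hi' := H i
  have e : φ ⟨X i ^ L, X_pow_mem hL i⟩ = Φ (Finsupp.single i L) := by
    have h := X_pow_mem (K := K) hL i
    rw [monomial_single_pow] at h
    rw [← hφ _ h]
    congr 2
    exact monomial_single_pow i L
  rw [e] at hi' 
  have c1 : Φ (Finsupp.single i L) = Ideal.Quotient.mk I (monomial (α + (Finsupp.single i L - Finsupp.single i 2)) 1) :=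
    if_pos (by simpa using hLN)
  rw [c1] at hi'
  have hi2 : s * X i * monomial (α + (Finsupp.single i L - Finsupp.single i 2)) 1 - f * X i ^ L ∈ I := by
    rw [← Ideal.Quotient.eq_zero_iff_mem, map_sub, sub_eq_zero]
    exact hi'
  have k1 := coeff_eq_zero hi2 (h1 (L - 1))
  have e5 : coeff (α + Finsupp.single i (L - 1)) (f * monomial (Finsupp.single i L) 1) = 0 := by
    rw [coeff_mul_monomial', if_neg]
    intro h
    have := h i
    simp [hα] at this
    omega
  rw [coeff_sub, monomial_single_pow, e5, sub_zero] at k1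
  · have e3 : s * X i * monomial (α + (Finsupp.single i L - Finsupp.single i 2)) 1 = s * monomial (α + Finsupp.single i (L - 1)) 1 := by
      rw [mul_assoc, X, monomial_mul]
      congr 2
      · congr 1
        ext x
        simp only [Finsupp.add_apply, Finsupp.tsub_apply, Finsupp.single_apply]
        split_ifs <;> omega
      · simp
    have e4 := coeff_mul_monomial (0 : Fin n →₀ ℕ) (α + Finsupp.single i (L - 1)) (1:K) s
    rw [zero_add] at e4
    rw [e3, e4, mul_one] at k1
    exact hs k1
end GraphAux

namespace GraphAux
open MvPolynomial
variable {K : Type} [Field K] {n : ℕ}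

lemma Gm_any {Δ : SimComplex n} (hgraph : ∀ F ∈ Δ.faces, F.card ≤ 2) {m : ℕ} {i j : Fin n} (hne : i ≠ j) {γ : Fin n →₀ ℕ} (hi : m ≤ γ i) (hj : m ≤ γ j)
    (hs : {i, j} ∈ Δ.faces → m ≤ ∑ k, if k = i ∨ k = j then 0 else γ k) : ∃ g ∈ Gm Δ m, g ≤ γ := by
  by_cases h : {i, j} ∈ Δ.faces
  · exact Gm_triple hgraph hne m hi hj (hs h)
  · exact Gm_pair hne h m hi hj

lemma le_sum_one {f : Fin n → ℕ} {m a : ℕ} {x : Fin n} (hx : a ≤ f x) (h : m ≤ a) : m ≤ ∑ k, f k :=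
  h.trans (hx.trans (Finset.single_le_sum (f := f) (fun _ _ => Nat.zero_le _) (Finset.mem_univ x)))

lemma le_sum_two {f : Fin n → ℕ} {m a b : ℕ} {x y : Fin n} (hxy : x ≠ y) (hx : a ≤ f x) (hy : b ≤ f y)
    (h : m ≤ a + b) : m ≤ ∑ k, f k := by
  have := Finset.sum_le_sum_of_subset (f := f) (Finset.subset_univ {x, y})
  rw [Finset.sum_pair hxy] at this
  omega

lemma sum_le_of {f g : Fin n → ℕ} (h : ∀ k, f k ≤ g k) {b : ℕ} (hg : ∑ k, g k ≤ b) : ∑ k, f k ≤ b :=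
  (Finset.sum_le_sum fun k _ => h k).trans hg

lemma sum_single_eq (d : Fin n) (c : ℕ) : ∑ k, Finsupp.single d c k = c := by
  rw [Finset.sum_eq_single d (fun b _ hb => by rw [Finsupp.single_apply, if_neg hb.symm]) (by simp), Finsupp.single_eq_same]

lemma deg_le_two {Δ : SimComplex n} (hgraph : ∀ F ∈ Δ.faces, F.card ≤ 2) {m : ℕ} (hm : 4 ≤ m) (hQ : PropQ (SRIdeal K Δ ^ m))
    (hV : ∀ i : Fin n, ({i} : Finset (Fin n)) ∈ Δ.faces) {i a b c : Fin n} 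
    (ha : {i, a} ∈ Δ.faces) (hb : {i, b} ∈ Δ.faces) (hc : {i, c} ∈ Δ.faces)
    (hia : a ≠ i) (hib : b ≠ i) (hic : c ≠ i) (hab : a ≠ b) (hac : a ≠ c) (hbc : b ≠ c) : False := by
  classical
  let α : Fin n →₀ ℕ := Finsupp.single a (m-1) + Finsupp.single b (m-1) + Finsupp.single c 1
  refine caseB hQ i α (by simp [α, hia, hib, hic]) m ?_ ?_
  · intro j hj
    refine Gm_any hgraph hj.symm (by simp; omega) (by simp) fun _ => ?_
    by_cases h0 : j = a
    · subst j
      exact le_sum_two (x := b) (y := c) (a := m-1) (b := 1) hbc (by simp [α, hib, hab.symm]) (by simp [α, hic, hac.symm]) (by omega)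
    by_cases h : j = b
    · subst j
      exact le_sum_two (x := a) (y := c) (a := m-1) (b := 1) hac (by simp [α, hia, hab]) (by simp [α, hic, hbc.symm]) (by omega)
    · exact le_sum_two (x := a) (y := b) (a := m-1) (b := m-1) hab (by simp [α, hia, Ne.symm h0]; omega) (by simp [α, hib, Ne.symm h]; omega) (by omega)
  · intro L hL
    have := Gm_weight (fun k => if k = i then 0 else if {i, k} ∈ Δ.faces then 1 else 2) 2 (fun F hF => ?_) hL
    · have e : ∑ k, (if k = i then 0 else if {i, k} ∈ Δ.faces then 1 else 2) * (α + Finsupp.single i L : Fin n →₀ ℕ) k =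
        (m - 1) + (m - 1) + 1 := by
        simp only [α, Finsupp.add_apply, mul_add, Finset.sum_add_distrib, Finsupp.single_apply]
        simp [hia, hib, hic, ha, hb, hc]
      rw [e] at this
      omega
    · by_contra hlt
      by_cases h2 : ∃ x ∈ F, x ≠ i ∧ {i, x} ∉ Δ.faces
      · obtain ⟨x, hx, hxi, hx'⟩ := h2
        apply hlt
        refine le_trans ?_ (Finset.single_le_sum (fun _ _ => Nat.zero_le _) hx)
        simp [hxi, hx']
      · push Not at h2
        apply hF
        have h3 : (F.erase i).card ≤ 1 := by
          have h5 : (F.erase i).card ≤ ∑ x ∈ F, (if x = i then 0 else if {i, x} ∈ Δ.faces then 1 else 2) := by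
            rw [Finset.card_eq_sum_ones]
            refine le_trans ?_ (Finset.sum_le_sum_of_subset (Finset.erase_subset i F))
            refine Finset.sum_le_sum fun x hx => ?_
            rw [if_neg (Finset.ne_of_mem_erase hx)]
            split_ifs <;> omega
          omega
        have : Nonempty (Fin n) := ⟨i⟩
        rw [Finset.card_le_one_iff_subset_singleton] at h3
        obtain ⟨x, hx⟩ := h3
        by_cases hxF : x ∈ F ∧ x ≠ i
        · refine Δ.down_closed (h2 x hxF.1 hxF.2) fun y hy => ?_
          by_cases hyi : y = i
          · simp [hyi]
          · have := hx (Finset.mem_erase.2 ⟨hyi, hy⟩)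
            simp at this; simp [this]
        · refine Δ.down_closed (hV i) fun y hy => ?_
          by_cases hyi : y = i
          · simp [hyi]
          · have := hx (Finset.mem_erase.2 ⟨hyi, hy⟩)
            simp at this; subst this; exact absurd ⟨hy, hyi⟩ hxF

lemma dist_two {Δ : SimComplex n} (hgraph : ∀ F ∈ Δ.faces, F.card ≤ 2) {m : ℕ} (hm : 4 ≤ m) (hQ : PropQ (SRIdeal K Δ ^ m))
    (hiso : ∀ v : Fin n, ∃ w : Fin n, w ≠ v ∧ ({v, w} : Finset (Fin n)) ∈ Δ.faces)
    {a d : Fin n} (had : a ≠ d) (hnot : {a, d} ∉ Δ.faces) : 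
    ∃ x, x ≠ a ∧ x ≠ d ∧ {a, x} ∈ Δ.faces ∧ {x, d} ∈ Δ.faces := by
  classical
  by_contra! hcon
  let α : Fin n →₀ ℕ := Finsupp.single a (m-2) + Finsupp.single d (m-2)
  obtain ⟨b, hba, hab⟩ := hiso a
  obtain ⟨e, hed, hde⟩ := hiso d
  have hbd : b ≠ d := by rintro rfl; exact hnot hab
  have hea : e ≠ a := by rintro rfl; rw [Finset.pair_comm] at hde; exact hnot hde
  refine caseA hQ {x | x = a ∨ {a, x} ∈ Δ.faces} α m ?_ a a d (Or.inl rfl) ?_ ?_ ?_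
  · intro i hi j hj
    have hij : i ≠ j := fun h => hj (h ▸ hi)
    simp only [Set.mem_ofPred_eq, not_or] at hi hj
    refine Gm_any hgraph hij (by simp; omega) (by simp) fun hf => ?_
    have hia : i ≠ a := by rintro rfl; exact hj.2 hf
    have hai : {a, i} ∈ Δ.faces := by tauto
    have hid : i ≠ d := by rintro rfl; exact hnot hai
    have hjd : j ≠ d := by rintro rfl; exact hcon i hia hid hai hf
    exact le_sum_two (x := a) (y := d) (a := m-2) (b := m-2) had 
      (by simp [α, hia.symm, Ne.symm hj.1]) (by simp [α, hid.symm, hjd.symm]) (by omega)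
  · simp only [Set.mem_ofPred_eq, not_or]; exact ⟨had.symm, hnot⟩
  · intro L hL
    have := Gm_edge hab hL
    have h2 : ∑ k, (if k = a ∨ k = b then 0 else (α + Finsupp.single a 1 + Finsupp.single a L : Fin n →₀ ℕ) k) ≤ m - 2 := by
      refine sum_le_of (g := fun k => Finsupp.single d (m-2) k) (fun k => ?_) (sum_single_eq _ _).le
      split_ifs with h
      · simp
      · push Not at h
        simp [α, Finsupp.single_apply, Ne.symm h.1]
    omega
  · intro L hL
    have := Gm_edge hde hL
    have h2 : ∑ k, (if k = d ∨ k = e then 0 else (α + Finsupp.single a 1 + Finsupp.single d L : Fin n →₀ ℕ) k) ≤ m - 1 := by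
      refine sum_le_of (g := fun k => Finsupp.single a (m-1) k) (fun k => ?_) (sum_single_eq _ _).le
      split_ifs with h
      · simp
      · push Not at h
        simp [α, Finsupp.single_apply, Ne.symm h.1]
        split_ifs <;> omega
    omega

lemma no_C5 {Δ : SimComplex n} (hgraph : ∀ F ∈ Δ.faces, F.card ≤ 2) {m : ℕ} (hm : 4 ≤ m) (hQ : PropQ (SRIdeal K Δ ^ m))
    {a b c d e : Fin n} (hab : a ≠ b) (hac : a ≠ c) (had : a ≠ d) (hae : a ≠ e) (hbc : b ≠ c)
    (hbd : b ≠ d) (hbe : b ≠ e) (hcd : c ≠ d) (hde : d ≠ e) 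
    (eab : {a, b} ∈ Δ.faces) (ecd : {d, c} ∈ Δ.faces)
    (hNa : ∀ x, x ≠ a → {a, x} ∈ Δ.faces → x = b ∨ x = e)
    (hNb : ∀ x, x ≠ b → {b, x} ∈ Δ.faces → x = a ∨ x = c) : False := by
  classical
  let α : Fin n →₀ ℕ := Finsupp.single a (m-3) + Finsupp.single b 1 + Finsupp.single d (m-1)
  refine caseA hQ {x | x = a ∨ x = b} α m ?_ a a d (Or.inl rfl) ?_ ?_ ?_
  · intro i hi j hj
    have hij : i ≠ j := fun h => hj (h ▸ hi)
    simp only [Set.mem_ofPred_eq, not_or] at hi hj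
    refine Gm_any hgraph hij (by simp; omega) (by simp) fun hf => ?_
    rcases hi with rfl | rfl
    · have : j = e := (hNa j hij.symm hf).resolve_left hj.2
      subst this
      exact le_sum_two (x := b) (y := d) (a := 1) (b := m-1) hbd
        (by simp [α, hab.symm, hbe]) (by simp [α, had.symm, hde]) (by omega)
    · have : j = c := (hNb j hij.symm hf).resolve_left hj.1
      subst this
      exact le_sum_two (x := a) (y := d) (a := m-3) (b := m-1) had
        (by simp [α, hab, hac]) (by simp [α, hbd.symm, hcd.symm]) (by omega)
  · simp only [Set.mem_ofPred_eq, not_or]; exact ⟨had.symm, hbd.symm⟩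
  · intro L hL
    have := Gm_edge eab hL
    have h2 : ∑ k, (if k = a ∨ k = b then 0 else (α + Finsupp.single a 1 + Finsupp.single a L : Fin n →₀ ℕ) k) ≤ m - 1 := by
      refine sum_le_of (g := fun k => Finsupp.single d (m-1) k) (fun k => ?_) (sum_single_eq _ _).le
      split_ifs with h
      · simp
      · push Not at h
        simp [α, Finsupp.single_apply, Ne.symm h.1, Ne.symm h.2]
    omega
  · intro L hL
    have := Gm_edge ecd hL
    have h2 : ∑ k, (if k = d ∨ k = c then 0 else (α + Finsupp.single a 1 + Finsupp.single d L : Fin n →₀ ℕ) k) ≤ m - 1 := by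
      refine sum_le_of (g := fun k => (Finsupp.single a (m-2) + Finsupp.single b 1 : Fin n →₀ ℕ) k) (fun k => ?_) ?_
      · split_ifs with h
        · simp
        · push Not at h
          simp [α, Finsupp.single_apply, Ne.symm h.1]
          split_ifs <;> omega
      · simp only [Finsupp.add_apply, Finset.sum_add_distrib, sum_single_eq]; omega
    omega

lemma CI_of_Q {Δ : SimComplex n} (hgraph : ∀ F ∈ Δ.faces, F.card ≤ 2) {m : ℕ} (hm : 4 ≤ m) (hQ : PropQ (SRIdeal K Δ ^ m))
    (hV : ∀ i : Fin n, ({i} : Finset (Fin n)) ∈ Δ.faces)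
    (hiso : ∀ v : Fin n, ∃ w : Fin n, w ≠ v ∧ ({v, w} : Finset (Fin n)) ∈ Δ.faces) :
    Δ.IsCompleteIntersection := by
  classical
  let A : Fin n → Fin n → Prop := fun x y => x ≠ y ∧ {x, y} ∈ Δ.faces
  have symm : ∀ x y, A x y → A y x := fun x y h => ⟨h.1.symm, by rw [Finset.pair_comm]; exact h.2⟩
  have deg : ∀ i a b c, A i a → A i b → A i c → a = b ∨ a = c ∨ b = c := by
    intro i a b c h1 h2 h3
    by_contra! h
    exact deg_le_two hgraph hm hQ hV h1.2 h2.2 h3.2 h1.1.symm h2.1.symm h3.1.symm h.1 h.2.1 h.2.2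
  have dist : ∀ a d, a ≠ d → ¬ A a d → ∃ x, A a x ∧ A x d := by
    intro a d had h
    obtain ⟨x, h1, h2, h3, h4⟩ := dist_two hgraph hm hQ hiso had (fun hh => h ⟨had, hh⟩)
    exact ⟨x, ⟨h1.symm, h3⟩, ⟨h2, h4⟩⟩
  have c5 : ∀ a b c d e, a ≠ b → a ≠ c → a ≠ d → a ≠ e → b ≠ c → b ≠ d → b ≠ e → c ≠ d → d ≠ e →
      A a b → A c d → (∀ x, A a x → x = b ∨ x = e) → (∀ x, A b x → x = a ∨ x = c) → False := by
    intro a b c d e h1 h2 h3 h4 h5 h6 h7 h8 h9 k1 k2 k3 k4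
    exact no_C5 hgraph hm hQ h1 h2 h3 h4 h5 h6 h7 h8 h9 k1.2 (symm _ _ k2).2 
      (fun x hx hx' => k3 x ⟨hx.symm, hx'⟩) (fun x hx hx' => k4 x ⟨hx.symm, hx'⟩)
  -- nonadjacent pairs
  have pp : ∀ x y z, x ≠ y → x ≠ z → ¬ A x y → ¬ A x z → y = z := by
    intro x y z hxy hxz h1 h2
    by_contra hyz
    obtain ⟨p, hp1, hp2⟩ := dist x y hxy h1
    obtain ⟨q, hq1, hq2⟩ := dist x z hxz h2
    have hpq : p ≠ q := by
      rintro rfl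
      have := deg p x y z (symm _ _ hp1) hp2 hq2
      tauto
    have Nx : ∀ w, A x w → w = p ∨ w = q := by
      intro w hw
      have := deg x p q w hp1 hq1 hw
      have e1 : p = w → w = p := Eq.symm
      have e2 : q = w → w = q := Eq.symm
      tauto
    have Np : ∀ w, A p w → w = x ∨ w = y := by
      intro w hw
      have := deg p x y w (symm _ _ hp1) hp2 hw
      have e1 : x = w → w = x := Eq.symm
      have e2 : y = w → w = y := Eq.symm
      tauto
    have Nq : ∀ w, A q w → w = x ∨ w = z := by
      intro w hw
      have := deg q x z w (symm _ _ hq1) hq2 hw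
      have e1 : x = w → w = x := Eq.symm
      have e2 : z = w → w = z := Eq.symm
      tauto
    have hpz : p ≠ z := by rintro rfl; exact h2 hp1
    have hqy : q ≠ y := by rintro rfl; exact h1 hq1
    by_cases hA : A y z
    · exact c5 x p y z q hp1.1 hxy hxz hq1.1 hp2.1 hpz hpq hyz hq2.1.symm hp1 hA Nx Np
    · obtain ⟨r, hr1, hr2⟩ := dist y z hyz hA
      have hrx : r ≠ x := by rintro rfl; exact h1 (symm _ _ hr1)
      have hrp : r ≠ p := by
        rintro rfl
        rcases Np z hr2 with h | h
        · exact hxz h.symm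
        · exact hyz h.symm
      have hrq : r ≠ q := by
        rintro rfl
        rcases Nq y (symm _ _ hr1) with h | h
        · exact hxy h.symm
        · exact hyz h
      have hxr : ¬ A x r := fun h => by rcases Nx r h with h | h <;> tauto
      obtain ⟨s, hs1, hs2⟩ := dist x r hrx.symm hxr
      rcases Nx s hs1 with rfl | rfl
      · rcases Np r hs2 with h | h
        · exact hrx h
        · exact hr1.1 h.symm
      · rcases Nq r hs2 with h | h
        · exact hrx h
        · exact hr2.1 h
  -- classification of minimal nonfaces through a vertex
  have hE : (∅ : Finset (Fin n)) ∈ Δ.faces → ∀ F, Δ.IsMinNonface F → ∀ x ∈ F, 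
      (∃ y, x ≠ y ∧ ¬ A x y ∧ F = {x, y}) ∨ (∃ y z, A x y ∧ A x z ∧ A y z ∧ F = {x, y, z}) := by
    intro h0 F hF x hx
    obtain ⟨-, hF1, hF2⟩ := hF
    by_cases hc : ∃ y ∈ F, x ≠ y ∧ ¬ A x y
    · obtain ⟨y, hy, hxy, hA⟩ := hc
      left
      refine ⟨y, hxy, hA, ?_⟩
      by_contra hne
      have hss : {x, y} ⊂ F := by
        refine Finset.ssubset_iff_subset_ne.2 ⟨?_, fun h => hne h.symm⟩
        intro w hw; simp at hw; rcases hw with rfl | rfl <;> assumption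
      exact hA ⟨hxy, hF2 _ hss⟩
    · push Not at hc
      right
      have h1 : ∃ y ∈ F, x ≠ y := by
        by_contra! h
        exact hF1 (Δ.down_closed (hV x) fun w hw => by simp [h w hw])
      obtain ⟨y, hy, hxy⟩ := h1
      have h2 : ∃ z ∈ F, x ≠ z ∧ y ≠ z := by
        by_contra! h
        refine hF1 (Δ.down_closed (hc y hy hxy).2 fun w hw => ?_)
        by_cases hxw : x = w
        · simp [hxw]
        · simp [h w hw hxw]
      obtain ⟨z, hz, hxz, hyz⟩ := h2
      have hFe : {x, y, z} = F := by
        by_contra hne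
        have hss : {x, y, z} ⊂ F := by
          refine Finset.ssubset_iff_subset_ne.2 ⟨?_, hne⟩
          intro w hw; simp at hw; rcases hw with rfl | rfl | rfl <;> assumption
        have := hgraph _ (hF2 _ hss)
        rw [Finset.card_eq_three.2 ⟨x, y, z, hxy, hxz, hyz, rfl⟩] at this
        omega
      refine ⟨y, z, hc y hy hxy, hc z hz hxz, ⟨hyz, hF2 _ ?_⟩, hFe.symm⟩
      rw [← hFe, Finset.ssubset_iff_of_subset (by simp)]
      exact ⟨x, by simp, by simp [hxy, hxz]⟩
  intro F G hF hG hne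
  rw [Finset.disjoint_left]
  intro x hxF hxG
  have h0 := Δ.down_closed (hV x) (Finset.empty_subset _)
  have tp : ∀ y z w, A x y → A x z → A y z → x ≠ w → ¬ A x w → False := by
    intro y z w h1 h2 h3 h4 h5
    obtain ⟨p, hp, hp'⟩ := dist x w h4 h5
    rcases deg x y z p h1 h2 hp with h | h | h
    · exact h3.1 h
    · subst h
      rcases deg y x z w (symm _ _ h1) h3 hp' with h | h | h
      · exact h2.1 h
      · exact h4 h
      · subst h; exact h5 h2
    · subst h
      rcases deg z x y w (symm _ _ h2) (symm _ _ h3) hp' with h | h | h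
      · exact h1.1 h
      · exact h4 h
      · subst h; exact h5 h1
  rcases hE h0 F hF x hxF with ⟨y, k1, k2, k3⟩ | ⟨y, z, k1, k2, k3, k4⟩ <;>
  rcases hE h0 G hG x hxG with ⟨y', l1, l2, l3⟩ | ⟨y', z', l1, l2, l3, l4⟩
  · apply hne
    rw [k3, l3, pp x y y' k1 l1 k2 l2]
  · exact tp _ _ _ l1 l2 l3 k1 k2
  · exact tp _ _ _ k1 k2 k3 l1 l2
  · apply hne
    rw [k4, l4]
    have a1 := deg x y z y' k1 k2 l1
    have a2 := deg x y z z' k1 k2 l2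
    have := k3.1
    have := l3.1
    rcases a1 with h | rfl | rfl
    · tauto
    · rcases a2 with h | rfl | rfl
      · tauto
      · tauto
      · rfl
    · rcases a2 with h | rfl | rfl
      · tauto
      · rw [Finset.pair_comm]
      · tauto
end GraphAux

namespace GraphAux
open MvPolynomial
variable {K : Type} [Field K] {n : ℕ}

open Classical in
noncomputable def PTmap (K : Type) [Field K] {n : ℕ} (T : Finset (Fin n)) : MvPolynomial (Fin n) K →ₐ[K] MvPolynomial (Fin n) K :=
  aeval fun i => if i ∈ T then X i else 0

noncomputable def PT (K : Type) [Field K] {n : ℕ} (T : Finset (Fin n)) : Ideal (MvPolynomial (Fin n) K) :=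
  RingHom.ker (PTmap K T)

instance PT_prime (T : Finset (Fin n)) : (PT K T).IsPrime := RingHom.ker_isPrime _

lemma X_mem_PT (T : Finset (Fin n)) (i : Fin n) : X i ∈ PT K T ↔ i ∉ T := by
  classical
  rw [PT, RingHom.mem_ker, PTmap, aeval_X]
  split_ifs with h <;> simp [h]

lemma PTmap_comp (T U : Finset (Fin n)) (h : T ⊆ U) (p : MvPolynomial (Fin n) K) :
    PTmap K T (PTmap K U p) = PTmap K T p := by
  classical
  have : (PTmap K T).comp (PTmap K U) = PTmap K T := by
    ext i : 1
    simp only [AlgHom.comp_apply, PTmap, aeval_X]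
    by_cases hi : i ∈ U
    · simp [hi]
    · simp [hi]; intro h'; exact absurd (h h') hi
  exact congrArg (fun f => f p) this

lemma PT_lt {T U : Finset (Fin n)} (h : T ⊂ U) : PT K U < PT K T := by
  obtain ⟨h1, i, hi, hi'⟩ := (Finset.ssubset_iff_of_subset h.1).1 h |>.elim fun i hi => (⟨h.1, i, hi.1, hi.2⟩ : T ⊆ U ∧ ∃ i, i ∈ U ∧ i ∉ T)
  refine lt_of_le_not_ge (fun p hp => ?_) fun hle => ?_
  · rw [PT, RingHom.mem_ker] at hp ⊢
    rw [← PTmap_comp T U h1, hp, map_zero]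
  · exact (X_mem_PT U i).1 (hle ((X_mem_PT T i).2 hi')) hi

lemma SR_le_PT {Δ : SimComplex n} {T : Finset (Fin n)} (hT : T ∈ Δ.faces) : SRIdeal K Δ ≤ PT K T := by
  rw [SRIdeal, Ideal.span_le]
  rintro p ⟨F, hF, rfl⟩
  have : ∃ i ∈ F, i ∉ T := by
    by_contra! h
    exact hF (Δ.down_closed hT h)
  obtain ⟨i, hi, hiT⟩ := this
  exact Ideal.mem_of_dvd _ (Finset.dvd_prod_of_mem _ hi) ((X_mem_PT T i).2 hiT)

lemma SR_pow_le_PT {Δ : SimComplex n} {T : Finset (Fin n)} (hT : T ∈ Δ.faces) {m : ℕ} (hm : m ≠ 0) :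
    SRIdeal K Δ ^ m ≤ PT K T := (Ideal.pow_le_self hm).trans (SR_le_PT hT)

lemma height_two {A : Type} [CommRing A] {p q r : Ideal A} [p.IsPrime] [q.IsPrime] [r.IsPrime]
    (h : p < q) (h' : q < r) : 2 ≤ r.height := by
  have h1 := Ideal.height_add_one_le_of_lt_of_isPrime h
  have h2 := Ideal.height_add_one_le_of_lt_of_isPrime h'
  calc (2 : ℕ∞) = 0 + 1 + 1 := by norm_num
    _ ≤ p.height + 1 + 1 := by gcongr; exact zero_le
    _ ≤ q.height + 1 := by gcongr
    _ ≤ _ := h2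

lemma map_prime {J P : Ideal (MvPolynomial (Fin n) K)} [P.IsPrime] (h : J ≤ P) :
   (P.map (Ideal.Quotient.mk J)).IsPrime :=
  Ideal.map_isPrime_of_surjective Ideal.Quotient.mk_surjective (by simpa using h)

lemma map_lt {J P Q : Ideal (MvPolynomial (Fin n) K)} (h : J ≤ P) (hPQ : P < Q) :
   P.map (Ideal.Quotient.mk J) < Q.map (Ideal.Quotient.mk J) := by
  refine lt_of_le_not_ge (Ideal.map_mono hPQ.le) fun hle => hPQ.not_ge ?_
  have := Ideal.comap_mono (f := Ideal.Quotient.mk J) hle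
  rw [Ideal.comap_map_mk h, Ideal.comap_map_mk (h.trans hPQ.le)] at this
  exact this

lemma height_origin {Δ : SimComplex n} (hedge : ∃ F ∈ Δ.faces, F.card = 2) {m : ℕ} (hm : m ≠ 0) :
    2 ≤ ((PT K (∅ : Finset (Fin n))).map (Ideal.Quotient.mk (SRIdeal K Δ ^ m))).height := by
  obtain ⟨F, hF, hc⟩ := hedge
  obtain ⟨i, j, hij, rfl⟩ := Finset.card_eq_two.1 hc
  have hi : {i} ∈ Δ.faces := Δ.down_closed hF (by simp)
  have h0 : ∅ ∈ Δ.faces := Δ.down_closed hF (by simp)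
  have l1 : ({i} : Finset (Fin n)) ⊂ {i, j} := by
    rw [Finset.ssubset_iff_of_subset (by simp)]; exact ⟨j, by simp, by simp [hij.symm]⟩
  have l0 : (∅ : Finset (Fin n)) ⊂ {i} := by simp
  have := map_prime (SR_pow_le_PT (K := K) hF hm)
  have := map_prime (SR_pow_le_PT (K := K) hi hm)
  have := map_prime (SR_pow_le_PT (K := K) h0 hm)
  exact height_two (map_lt (SR_pow_le_PT hF hm) (PT_lt l1)) (map_lt (SR_pow_le_PT hi hm) (PT_lt l0))

lemma one_lt_dim {Δ : SimComplex n} (hedge : ∃ F ∈ Δ.faces, F.card = 2) {m : ℕ} (hm : m ≠ 0) :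
    ((1 : ℕ) : WithBot ℕ∞) < ringKrullDim (MvPolynomial (Fin n) K ⧸ SRIdeal K Δ ^ m) := by
  have h0 : ∅ ∈ Δ.faces := by
    obtain ⟨F, hF, hc⟩ := hedge
    exact Δ.down_closed hF (by simp)
  have := map_prime (SR_pow_le_PT (K := K) h0 hm)
  refine lt_of_lt_of_le ?_ (Ideal.height_le_ringKrullDim_of_isPrime (I := (PT K (∅ : Finset (Fin n))).map (Ideal.Quotient.mk (SRIdeal K Δ ^ m))))
  refine lt_of_lt_of_le ?_ (WithBot.coe_le_coe.2 (height_origin hedge hm))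
  exact_mod_cast (Nat.lt_succ_self 1)

lemma Q_of_qB {Δ : SimComplex n} (hedge : ∃ F ∈ Δ.faces, F.card = 2) {m : ℕ} (hm : m ≠ 0)
    (h : IsQuasiBuchsbaum K (SRIdeal K Δ ^ m)) : PropQ (SRIdeal K Δ ^ m) := by
  intro l φ k
  obtain ⟨L, hL, b, hb⟩ := ExtAux.lc_Q (maxIdeal K n) (ModuleCat.of _ (MvPolynomial (Fin n) K ⧸ SRIdeal K Δ ^ m)) (X k)
    (h 1 (one_lt_dim hedge hm) (X k) (Ideal.subset_span ⟨k, rfl⟩)) l φ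
  obtain ⟨f, rfl⟩ := Ideal.Quotient.mk_surjective b
  refine ⟨1, f, L, hL, by simp, fun i => ?_⟩
  rw [one_mul]
  refine (hb (X i ^ L) (X_pow_mem le_rfl i)).trans ?_
  rw [mul_comm]
  rfl

lemma qB_of_B {I : Ideal (MvPolynomial (Fin n) K)} (h : IsBuchsbaum K I) : IsQuasiBuchsbaum K I := by
  intro i hi x hx y
  exact ExtAux.lc_kill (maxIdeal K n) i _ (h i hi) x hx y
end GraphAux

namespace GraphAux
open MvPolynomial

section
variable {S B : Type} [CommRing S] [CommRing B] [IsLocalRing B] [Algebra S B] (q : Ideal S)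

lemma ext_lin_one (hm : ∀ s, algebraMap S B s ∈ IsLocalRing.maximalIdeal B → s ∈ q)
    (hloc : ∀ b : B, ∃ s t, IsUnit (algebraMap S B t) ∧ algebraMap S B t * b = algebraMap S B s)
    (h0 : ∀ b : B, (∀ a ∈ q, algebraMap S B a * b = 0) → b = 0)
    (h1 : ∀ ψ : IsLocalRing.maximalIdeal B →ₗ[B] B, ∃ b, ∀ j : IsLocalRing.maximalIdeal B, ψ j = (j : B) • b)
    (hm' : ∀ s ∈ q, algebraMap S B s ∈ IsLocalRing.maximalIdeal B)
    (φ : q →ₗ[S] B) : ∃ b, ∀ a : q, φ a = algebraMap S B a * b := by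
  have ex : ∀ z : IsLocalRing.maximalIdeal B, ∃ (s : q) (t : S), IsUnit (algebraMap S B t) ∧ algebraMap S B t * z = algebraMap S B s := by
    intro z
    obtain ⟨s, t, ht, h⟩ := hloc z
    exact ⟨⟨s, hm s (h ▸ Ideal.mul_mem_left _ _ z.2)⟩, t, ht, h⟩
  have key : ∀ d : q, algebraMap S B d = 0 → φ d = 0 := by
    intro d hd
    refine h0 _ fun a ha => ?_
    have : a • φ d = (d : S) • φ ⟨a, ha⟩ := by
      rw [← map_smul, ← map_smul]
      congr 1
      ext
      simp [mul_comm]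
    rw [← Algebra.smul_def, this, Algebra.smul_def, hd, zero_mul]
  have key2 : ∀ (c c' : S) (s s' : q), algebraMap S B (c * s) = algebraMap S B (c' * s') → 
      algebraMap S B c * φ s = algebraMap S B c' * φ s' := by
    intro c c' s s' h
    have := key (c • s - c' • s') (by simp [map_sub] at h ⊢; rw [h, sub_self])
    rw [map_sub, map_smul, map_smul, sub_eq_zero, Algebra.smul_def, Algebra.smul_def] at this
    exact this
  choose sN tN hu hst using ex
  have char : ∀ (z : IsLocalRing.maximalIdeal B) (s : q) (t : S), algebraMap S B t * z = algebraMap S B s → 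
      algebraMap S B t * (((hu z).unit⁻¹ : Bˣ) * φ (sN z)) = φ s := by
    intro z s t h
    have h2 := key2 t (tN z) (sN z) s (by
      rw [map_mul, map_mul, ← h, ← hst]; ring)
    rw [mul_left_comm, h2, ← mul_assoc]
    rw [IsUnit.val_inv_mul, one_mul]
  let ψ : IsLocalRing.maximalIdeal B →ₗ[B] B :=
    { toFun := fun z => ((hu z).unit⁻¹ : Bˣ) * φ (sN z)
      map_add' := by
        intro x y
        apply ((hu x).mul ((hu y).mul (hu (x+y)))).mul_left_cancel
        have e1 := char x (sN x) _ (hst x)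
        have e2 := char y (sN y) _ (hst y)
        have e3 := char (x+y) (sN _) _ (hst _)
        have e4 := char (x+y) (tN y • sN x + tN x • sN y) (tN x * tN y) (by
          have := hst x
          have := hst y
          simp only [map_mul, map_add, Submodule.coe_add, SetLike.val_smul, smul_eq_mul]
          rw [← hst x, ← hst y]; ring)
        rw [map_add, map_smul, map_smul, Algebra.smul_def, Algebra.smul_def] at e4
        rw [← e1, ← e2] at e4
        rw [map_mul] at e4
        linear_combination (algebraMap S B (tN (x+y))) * e4
      map_smul' := by
        intro c x
        obtain ⟨s, t, ht, h⟩ := hloc c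
        simp only [RingHom.id_apply, smul_eq_mul]
        apply (ht.mul (hu x)).mul_left_cancel
        have e1 := char x (sN x) _ (hst x)
        have e2 := char (c • x) (s • sN x) (t * tN x) (by
          simp only [map_mul, SetLike.val_smul, smul_eq_mul]
          rw [← hst x, ← h]; ring)
        rw [map_smul, Algebra.smul_def] at e2
        rw [map_mul] at e2
        rw [e2, ← h]
        linear_combination (- algebraMap S B t * c) * e1 }
  obtain ⟨b, hb⟩ := h1 ψ
  refine ⟨b, fun a => ?_⟩
  have := char ⟨algebraMap S B a, hm' _ a.2⟩ a 1 (by simp)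
  have e := hb ⟨algebraMap S B a, hm' _ a.2⟩
  rw [map_one, one_mul] at this
  rw [← this]
  exact e

lemma ext_lin_pow
    (h0 : ∀ b : B, (∀ a ∈ q, algebraMap S B a * b = 0) → b = 0)
    (h1 : ∀ φ : q →ₗ[S] B, ∃ b, ∀ a : q, φ a = algebraMap S B a * b) (k : ℕ) :
    ∀ φ : ↥(q ^ k) →ₗ[S] B, ∃ b, ∀ a : ↥(q ^ k), φ a = algebraMap S B a * b := by
  induction k with
  | zero =>
    intro φ
    refine ⟨φ ⟨1, by simp⟩, fun a => ?_⟩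
    rw [← Algebra.smul_def, ← map_smul]
    congr 1
    ext; simp
  | succ k ih =>
    intro φ
    have hmem : ∀ (y : ↥(q ^ k)) (a : q), (a : S) * y ∈ q ^ (k+1) := fun y a => by
      rw [pow_succ']; exact Ideal.mul_mem_mul a.2 y.2
    have hex : ∀ y : ↥(q ^ k), ∃ b, ∀ a : q, φ ⟨a * y, hmem y a⟩ = algebraMap S B a * b := by
      intro y
      refine h1 { toFun := fun a => φ ⟨a * y, hmem y a⟩, map_add' := ?_, map_smul' := ?_ }
      · intro a a'
        rw [← map_add]; congr 1; ext; simp [add_mul]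
      · intro c a
        rw [← map_smul]; congr 1; ext; simp [mul_assoc]
    choose β hβ using hex
    have uniq : ∀ (y : ↥(q ^ k)) b, (∀ a : q, φ ⟨a * y, hmem y a⟩ = algebraMap S B a * b) → β y = b := by
      intro y b h
      rw [← sub_eq_zero]
      refine h0 _ fun a ha => ?_
      rw [mul_sub, ← hβ y ⟨a, ha⟩, ← h ⟨a, ha⟩, sub_self]
    obtain ⟨c, hc⟩ := ih
      { toFun := β
        map_add' := fun y y' => uniq _ _ fun a => by
          rw [mul_add, ← hβ, ← hβ, ← map_add]; congr 1; ext; simp [mul_add]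
        map_smul' := fun r y => uniq _ _ fun a => by
          simp only [RingHom.id_apply]
          rw [mul_smul_comm, ← hβ, ← map_smul]; congr 1; ext; simp [mul_left_comm] }
    refine ⟨c, fun a => ?_⟩
    obtain ⟨a, ha⟩ := a
    have ha' := ha
    rw [pow_succ'] at ha'
    change φ ⟨a, ha⟩ = algebraMap S B a * c
    refine Submodule.mul_induction_on' (C := fun x hx => φ ⟨x, by rw [pow_succ']; exact hx⟩ = algebraMap S B x * c) ?_ ?_ ha'
    · intro x hx y hy
      have e1 := hβ ⟨y, hy⟩ ⟨x, hx⟩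
      have e2 := hc ⟨y, hy⟩
      simp only [LinearMap.coe_mk, AddHom.coe_mk] at e2
      rw [e2] at e1
      rw [map_mul, mul_assoc]
      exact e1
    · intro x hx y hy ex ey
      rw [map_add, add_mul, ← ex, ← ey, ← map_add]
      rfl

lemma local_gen {A : Type} [CommRing A] [Algebra S A] [Algebra A B] [IsScalarTower S A B]
    (hsurj : Function.Surjective (algebraMap S A)) (P : Ideal A) [P.IsPrime] [IsLocalization.AtPrime B P]
    (hq : ∀ s, s ∈ q ↔ algebraMap S A s ∈ P)
    (e0 : ∀ b : B, (∀ z ∈ IsLocalRing.maximalIdeal B, z • b = 0) → b = 0)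
    (e1 : ∀ ψ : IsLocalRing.maximalIdeal B →ₗ[B] B, ∃ b, ∀ j : IsLocalRing.maximalIdeal B, ψ j = (j : B) • b)
    {l : ℕ} (φ : ↥(q ^ l) →ₗ[S] A) {ι : Type} [Fintype ι] (g : ι → ↥(q ^ l)) :
    ∃ s, s ∉ q ∧ ∃ f, ∀ i, s • φ (g i) = algebraMap S A (f * g i) := by
  classical
  have hmem : ∀ s, algebraMap S B s ∈ IsLocalRing.maximalIdeal B ↔ s ∈ q := by
    intro s
    rw [IsScalarTower.algebraMap_apply S A B, IsLocalization.AtPrime.to_map_mem_maximal_iff B P, hq]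
  have hunit : ∀ s, s ∉ q → IsUnit (algebraMap S B s) := by
    intro s hs
    rw [← hmem] at hs
    simpa using hs
  have hloc : ∀ b : B, ∃ s t, (t ∉ q) ∧ algebraMap S B t * b = algebraMap S B s := by
    intro b
    obtain ⟨⟨a, t⟩, ht⟩ := IsLocalization.surj P.primeCompl b
    obtain ⟨s, hs⟩ := hsurj a
    obtain ⟨t', ht'⟩ := hsurj t.1
    refine ⟨s, t', ?_, ?_⟩
    · rw [hq, ht']; exact t.2
    · rw [IsScalarTower.algebraMap_apply S A B,
        IsScalarTower.algebraMap_apply S A B s]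
      rw [hs, ht', mul_comm]; exact ht
  have hz : ∀ b : B, (∀ a ∈ q, algebraMap S B a * b = 0) → b = 0 := by
    intro b hb
    refine e0 b fun z hz => ?_
    obtain ⟨s, t, ht, hst⟩ := hloc z
    apply (hunit t ht).mul_left_cancel
    rw [smul_eq_mul, ← mul_assoc, hst, mul_zero]
    exact hb s ((hmem s).1 (hst ▸ Ideal.mul_mem_left _ _ hz))
  have main := ext_lin_pow q hz (ext_lin_one _ (fun s => (hmem s).1) 
    (fun b => by obtain ⟨s, t, ht, h⟩ := hloc b; exact ⟨s, t, hunit t ht, h⟩) hz e1 (fun s => (hmem s).2))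
  obtain ⟨b, hb⟩ := main l ((IsScalarTower.toAlgHom S A B).toLinearMap.comp φ)
  obtain ⟨s, t, ht, hst⟩ := hloc b
  have hex : ∀ i, ∃ c, c ∉ q ∧ (c * t) • φ (g i) = algebraMap S A (c * s * g i) := by
    intro i
    have h1 := hb (g i)
    simp only [LinearMap.comp_apply, AlgHom.toLinearMap_apply, IsScalarTower.coe_toAlgHom'] at h1
    have h2 : algebraMap A B (algebraMap S A t * φ (g i)) = algebraMap A B (algebraMap S A (s * g i)) := by
      rw [map_mul, h1, ← IsScalarTower.algebraMap_apply, ← IsScalarTower.algebraMap_apply, map_mul, ← hst]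
      ring
    rw [IsLocalization.eq_iff_exists P.primeCompl] at h2
    obtain ⟨c, hc⟩ := h2
    obtain ⟨c', hc'⟩ := hsurj c.1
    refine ⟨c', by rw [hq, hc']; exact c.2, ?_⟩
    rw [Algebra.smul_def, map_mul, mul_assoc, hc', hc, ← hc', ← map_mul, mul_assoc]
  choose c hc hc' using hex
  have hqp : q.IsPrime := by
    have : q = P.comap (algebraMap S A) := by ext s; rw [hq]; rfl
    rw [this]; infer_instance
  refine ⟨(∏ i, c i) * t, ?_, (∏ i, c i) * s, fun i => ?_⟩
  · intro h
    rcases hqp.mem_or_mem h with h | h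
    · obtain ⟨i, -, hi⟩ := (Ideal.IsPrime.prod_mem_iff (p := q)).1 h
      exact hc i hi
    · exact ht h
  · rw [← Finset.prod_erase_mul _ _ (Finset.mem_univ i), mul_assoc, mul_smul, hc', Algebra.smul_def, ← map_mul]
    congr 1; ring
end
variable {K : Type} [Field K] {n : ℕ}

lemma mem_PT_empty {s : MvPolynomial (Fin n) K} : s ∈ PT K ∅ ↔ coeff 0 s = 0 := by
  rw [PT, RingHom.mem_ker, PTmap]
  simp only [Finset.notMem_empty, if_false]
  have : (aeval fun _ : Fin n => (0 : MvPolynomial (Fin n) K)) s = algebraMap K _ (constantCoeff s) := aeval_zero' s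
  rw [this, constantCoeff_eq]
  simp

lemma maxIdeal_eq_PT : maxIdeal K n = PT K ∅ := by
  ext s
  rw [mem_PT_empty, maxIdeal_eq, ← pow_one (idealOfVars (Fin n) K), mem_pow_idealOfVars_iff']
  constructor
  · intro h; exact h 0 (by simp)
  · intro h x hx
    have : x = 0 := (Finsupp.degree_eq_zero_iff x).1 (by simpa using hx)
    rw [this, h]

lemma Q_of_CM {Δ : SimComplex n} (hedge : ∃ F ∈ Δ.faces, F.card = 2) {m : ℕ} (hm : m ≠ 0)
    (h : IsCohenMacaulayIdeal (SRIdeal K Δ ^ m)) : PropQ (SRIdeal K Δ ^ m) := by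
  classical
  have ho := height_origin (K := K) hedge hm
  have h0 : ∅ ∈ Δ.faces := by
    obtain ⟨F, hF, hc⟩ := hedge
    exact Δ.down_closed hF (by simp)
  have hIP : SRIdeal K Δ ^ m ≤ PT K ∅ := SR_pow_le_PT (K := K) h0 hm
  generalize SRIdeal K Δ ^ m = I at *
  have hP : ((PT K (∅ : Finset (Fin n))).map (Ideal.Quotient.mk I)).IsPrime := map_prime hIP
  have hcomap := Ideal.comap_map_mk hIP
  generalize (PT K (∅ : Finset (Fin n))).map (Ideal.Quotient.mk I) = P at *
  have hdim : (2 : WithBot ℕ∞) ≤ ringKrullDim (Localization.AtPrime P) := by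
    rw [IsLocalization.AtPrime.ringKrullDim_eq_height P (Localization.AtPrime P)]
    exact WithBot.coe_le_coe.2 ho
  have e0 := h P hP 0 (lt_of_lt_of_le (by norm_num) hdim)
  have e1 := h P hP 1 (lt_of_lt_of_le (by norm_num) hdim)
  replace e0 := (ExtAux.ext_zero_iff (R := Localization.AtPrime P) (ModuleCat.of _ (Localization.AtPrime P))).1 e0
  replace e1 := ExtAux.of_ext_one (R := Localization.AtPrime P) (ModuleCat.of _ (Localization.AtPrime P)) e1
  intro l φ k
  obtain ⟨s, hs, f, hf⟩ := local_gen (B := Localization.AtPrime P) (maxIdeal K n) Ideal.Quotient.mk_surjective P 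
    (fun s => by rw [maxIdeal_eq_PT, ← hcomap]; rfl) e0 e1 φ (fun i => ⟨X i ^ l, X_pow_mem le_rfl i⟩)
  refine ⟨s, f * X k, l, le_rfl, ?_, fun i => ?_⟩
  · rwa [maxIdeal_eq_PT, mem_PT_empty] at hs
  · rw [mul_comm, mul_smul, hf]
    change Ideal.Quotient.mk I (X k * (f * X i ^ l)) = _
    congr 1; ring
end GraphAux

namespace GraphAux
open MvPolynomial

section
variable {R A : Type} [CommRing R] [IsDomain R] [CommRing A]

def Good (φ : R →+* A) : Prop :=
  (∃ (ι : Type) (e : A ≃+ (ι →₀ R)), ∀ r a, e (φ r * a) = r • e a) ∧ φ.IsIntegral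

lemma Good.reg {φ : R →+* A} (h : Good φ) {f : R} (hf : f ≠ 0) (a : A) (ha : φ f * a = 0) : a = 0 := by
  obtain ⟨⟨ι, e, he⟩, -⟩ := h
  apply e.injective
  have := he f a
  rw [ha, map_zero] at this
  rw [map_zero]
  exact (smul_eq_zero.1 this.symm).resolve_left hf

lemma Good.reg2 {φ : R →+* A} (h : Good φ) {f g : R} (hf : f ≠ 0) (hfg : ∀ r, f ∣ g * r → f ∣ r) (a a' : A) 
    (ha : φ g * a = φ f * a') : ∃ a'', a = φ f * a'' := by
  obtain ⟨⟨ι, e, he⟩, -⟩ := h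
  have h1 : ∀ i, g * e a i = f * e a' i := by
    intro i
    have := congrArg (fun z => e z i) ha
    simpa [he] using this
  have h2 : ∀ i, ∃ c, e a i = f * c := fun i => hfg _ ⟨_, h1 i⟩
  choose c hc using h2
  let C : ι →₀ R := Finsupp.onFinset (e a).support c (fun i hi => by
    rw [Finsupp.mem_support_iff, hc]; exact mul_ne_zero hf hi)
  refine ⟨e.symm C, e.injective ?_⟩
  rw [he, AddEquiv.apply_symm_apply]
  ext i
  rw [hc i]
  rfl

lemma Good.comap_lt {φ : R →+* A} (h : Good φ) {P Q : Ideal A} [P.IsPrime] (hPQ : P < Q) : P.comap φ < Q.comap φ := by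
  let := φ.toAlgebra
  have : Algebra.IsIntegral R A := ⟨h.2⟩
  exact Ideal.IsIntegral.comap_lt_comap hPQ

lemma Good.dim_le {φ : R →+* A} (h : Good φ) : ringKrullDim A ≤ ringKrullDim R := by
  refine Order.krullDim_le_of_strictMono (fun P : PrimeSpectrum A => PrimeSpectrum.comap φ P) fun P Q hPQ => ?_
  exact h.comap_lt (P := P.asIdeal) (Q := Q.asIdeal) hPQ

lemma chain_one [IsNoetherianRing A] (P : Ideal A) [P.IsPrime] (h : 1 ≤ P.height) : 
    ∃ Q : Ideal A, Q.IsPrime ∧ Q < P := by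
  obtain ⟨l, hl, hlen⟩ := P.exists_ltSeries_length_eq_height
  rw [← hlen] at h
  have h1 : 1 ≤ l.length := by exact_mod_cast h
  refine ⟨(l ⟨l.length - 1, by omega⟩).asIdeal, (l _).isPrime, ?_⟩
  have : l ⟨l.length - 1, by omega⟩ < l (Fin.last _) := l.strictMono (by
    rw [Fin.lt_def]; simp; omega)
  have h3 : l (Fin.last _) = ⟨P, inferInstance⟩ := hl
  rw [h3] at this
  exact this

lemma chain_two [IsNoetherianRing A] (P : Ideal A) [P.IsPrime] (h : 2 ≤ P.height) : 
    ∃ Q Q' : Ideal A, Q.IsPrime ∧ Q'.IsPrime ∧ Q < Q' ∧ Q' < P := by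
  obtain ⟨l, hl, hlen⟩ := P.exists_ltSeries_length_eq_height
  rw [← hlen] at h
  have h1 : 2 ≤ l.length := by exact_mod_cast h
  refine ⟨(l ⟨l.length - 2, by omega⟩).asIdeal, (l ⟨l.length - 1, by omega⟩).asIdeal, (l _).isPrime, (l _).isPrime, ?_, ?_⟩
  · have : l ⟨l.length - 2, by omega⟩ < l ⟨l.length - 1, by omega⟩ := l.strictMono (by
      rw [Fin.lt_def]; simp; omega)
    exact this
  have : l ⟨l.length - 1, by omega⟩ < l (Fin.last _) := l.strictMono (by
    rw [Fin.lt_def]; simp; omega)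
  have h3 : l (Fin.last _) = ⟨P, inferInstance⟩ := hl
  rw [h3] at this
  exact this

lemma Good.CM [IsNoetherianRing A] [UniqueFactorizationMonoid R] {φ : R →+* A} (h : Good φ) (hdim : ringKrullDim R ≤ 2) : 
    IsCohenMacaulayRing A := by
  intro P hP
  have hh : ringKrullDim (Localization.AtPrime P) = P.height := IsLocalization.AtPrime.ringKrullDim_eq_height P _
  intro i hi
  have hi2 : i < 2 := by
    have : (i : WithBot ℕ∞) < 2 := lt_of_lt_of_le hi (by
      rw [hh]; exact Ideal.height_le_ringKrullDim_of_isPrime.trans (h.dim_le.trans hdim))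
    exact_mod_cast this
  rw [hh] at hi
  have hi' : (i : ℕ∞) + 1 ≤ P.height := Order.add_one_le_of_lt (by exact_mod_cast hi)
  have hmem : ∀ f, f ∈ P.comap φ → algebraMap A (Localization.AtPrime P) (φ f) ∈ IsLocalRing.maximalIdeal (Localization.AtPrime P) := by
    intro f hf
    rw [IsLocalization.AtPrime.to_map_mem_maximal_iff _ P]; exact hf
  have reg : ∀ f, f ≠ 0 → ∀ b : Localization.AtPrime P, algebraMap A (Localization.AtPrime P) (φ f) • b = 0 → b = 0 := by
    intro f hf b hb
    obtain ⟨a, s, rfl⟩ := IsLocalization.exists_mk'_eq P.primeCompl b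
    rw [smul_eq_mul, IsLocalization.mul_mk'_eq_mk'_of_mul, IsLocalization.mk'_eq_zero_iff] at hb
    obtain ⟨c, hc⟩ := hb
    rw [IsLocalization.mk'_eq_zero_iff]
    exact ⟨c, h.reg hf _ (by rw [← hc]; ring)⟩
  interval_cases i
  · obtain ⟨Q, hQ, hQP⟩ := chain_one P (by simpa using hi')
    have := h.comap_lt hQP
    obtain ⟨f, hf, hf0⟩ := (Submodule.ne_bot_iff _).1 (lt_of_le_of_lt bot_le this).ne'
    refine (ExtAux.ext_zero_iff (R := Localization.AtPrime P) (ModuleCat.of _ (Localization.AtPrime P))).2 fun b hb => ?_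
    exact reg f hf0 b (hb _ (hmem f hf))
  · obtain ⟨Q, Q', hQ, hQ', hQQ, hQP⟩ := chain_two P (by simpa [one_add_one_eq_two] using hi')
    have l1 := h.comap_lt hQQ
    have l2 := h.comap_lt hQP
    have hp : (Q'.comap φ).IsPrime := inferInstance
    obtain ⟨f, hf, hfp⟩ := hp.exists_mem_prime_of_ne_bot (lt_of_le_of_lt bot_le l1).ne'
    obtain ⟨g, hg, hg'⟩ := Set.exists_of_ssubset l2
    have hfg : ∀ r, f ∣ g * r → f ∣ r := fun r hr => (hfp.dvd_or_dvd hr).resolve_left fun hd =>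
      hg' (Ideal.mem_of_dvd _ hd hf)
    refine ExtAux.ext_zero_one_of_regular (R := Localization.AtPrime P) (ModuleCat.of _ (Localization.AtPrime P))
      _ _ (hmem f (l2.le hf)) (hmem g hg) (reg f hfp.ne_zero) ?_
    intro b b' hb
    change Localization.AtPrime P at b b'
    change algebraMap A (Localization.AtPrime P) (φ g) * b = algebraMap A (Localization.AtPrime P) (φ f) * b' at hb
    obtain ⟨a, s, rfl⟩ := IsLocalization.exists_mk'_eq P.primeCompl b
    obtain ⟨a', s', rfl⟩ := IsLocalization.exists_mk'_eq P.primeCompl b'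
    rw [IsLocalization.mul_mk'_eq_mk'_of_mul, IsLocalization.mul_mk'_eq_mk'_of_mul, IsLocalization.mk'_eq_iff_eq,
      IsLocalization.eq_iff_exists P.primeCompl] at hb
    obtain ⟨c, hc⟩ := hb
    obtain ⟨a'', ha''⟩ := h.reg2 hfp.ne_zero hfg (c * s' * a) (c * s * a') (by linear_combination hc)
    refine ⟨IsLocalization.mk' _ a'' (c * s' * s), ?_⟩
    change IsLocalization.mk' _ a s = algebraMap A (Localization.AtPrime P) (φ f) * _
    rw [IsLocalization.mul_mk'_eq_mk'_of_mul, ← ha'', IsLocalization.mk'_eq_iff_eq]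
    congr 1
    push_cast
    ring
end

section
variable {K : Type} [Field K] {n : ℕ}

lemma dimR : ringKrullDim (MvPolynomial (Fin 2) K) ≤ 2 := by
  rw [MvPolynomial.ringKrullDim_of_isNoetherianRing, ringKrullDim_eq_zero_of_field]
  simp

lemma Good.B {I : Ideal (MvPolynomial (Fin n) K)} {φ : MvPolynomial (Fin 2) K →+* MvPolynomial (Fin n) K ⧸ I} (h : Good φ)
    (f : Fin 2 → MvPolynomial (Fin n) K) (hf : ∀ i, f i ∈ maxIdeal K n) (hφ : ∀ i, φ (X i) = Ideal.Quotient.mk I (f i)) :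
    IsBuchsbaum K I := by
  intro i hi
  have hi2 : i < 2 := by
    have : (i : WithBot ℕ∞) < 2 := lt_of_lt_of_le hi (h.dim_le.trans dimR)
    exact_mod_cast this
  refine ExtAux.lc_surj (maxIdeal K n) i _ fun k => ?_
  have hne : (X 0 : MvPolynomial (Fin 2) K) ^ k ≠ 0 := pow_ne_zero _ (X_ne_zero 0)
  have e : ∀ (j : Fin 2) (a : MvPolynomial (Fin n) K ⧸ I), f j ^ k • a = φ (X j ^ k) * a := by
    intro j a
    rw [map_pow, hφ, ← map_pow]
    rfl
  have hreg : ∀ a : MvPolynomial (Fin n) K ⧸ I, f 0 ^ k • a = 0 → a = 0 := by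
    intro a ha
    rw [e] at ha
    exact h.reg hne a ha
  interval_cases i
  · exact (ExtAux.ext_zero_iff (J := maxIdeal K n ^ k) (ModuleCat.of _ (MvPolynomial (Fin n) K ⧸ I))).2 fun a ha => 
      hreg a (ha _ (Ideal.pow_mem_pow (hf 0) k))
  · refine ExtAux.ext_zero_one_of_regular (J := maxIdeal K n ^ k) (ModuleCat.of _ (MvPolynomial (Fin n) K ⧸ I))
      _ _ (Ideal.pow_mem_pow (hf 0) k) (Ideal.pow_mem_pow (hf 1) k) hreg ?_
    intro a a' ha
    change MvPolynomial (Fin n) K ⧸ I at a a'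
    change f 1 ^ k • a = f 0 ^ k • a' at ha
    rw [e, e] at ha
    have hfg : ∀ r : MvPolynomial (Fin 2) K, (X 0 : MvPolynomial (Fin 2) K) ^ k ∣ X 1 ^ k * r → (X 0 : MvPolynomial (Fin 2) K) ^ k ∣ r := by
      intro r hr
      have hp : Prime (X 0 : MvPolynomial (Fin 2) K) := X_prime
      refine hp.pow_dvd_of_dvd_mul_left k (fun hd => ?_) hr
      have := hp.dvd_of_dvd_pow hd
      rw [X_dvd_X] at this
      simp at this
    obtain ⟨a'', h''⟩ := h.reg2 hne hfg a a' ha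
    exact ⟨a'', by rw [h'', ← e]⟩
end
end GraphAux

namespace GraphAux
open MvPolynomial

section
variable {R A : Type} [CommRing R] [IsDomain R] [CommRing A]

lemma Good.of_equiv (D : Type) [CommRing D] [Algebra R D] [Module.Free R D] [Algebra.IsIntegral R D] (E : A ≃+* D) :
    Good ((E.symm : D →+* A).comp (algebraMap R D)) := by
  constructor
  · let b := Module.Free.chooseBasis R D
    obtain ⟨ι, ⟨b⟩⟩ : ∃ ι : Type, Nonempty (Module.Basis ι R D) := ⟨_, ⟨b⟩⟩
    refine ⟨ι, E.toAddEquiv.trans b.repr.toAddEquiv, fun r a => ?_⟩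
    have : E (((E.symm : D →+* A).comp (algebraMap R D)) r * a) = r • E a := by
      rw [map_mul, Algebra.smul_def]; simp
    change b.repr (E _) = r • b.repr (E a)
    rw [this, map_smul]
  · refine RingHom.IsIntegral.trans _ _ (algebraMap_isIntegral_iff.2 inferInstance) ?_
    exact RingHom.isIntegral_of_surjective _ E.symm.surjective
end

section
variable {K : Type} [Field K] {n : ℕ}

def Nice (I : Ideal (MvPolynomial (Fin n) K)) : Prop :=
  ∃ φ : MvPolynomial (Fin 2) K →+* MvPolynomial (Fin n) K ⧸ I, Good φ ∧
    ∃ f : Fin 2 → MvPolynomial (Fin n) K, (∀ i, f i ∈ maxIdeal K n) ∧ ∀ i, φ (X i) = Ideal.Quotient.mk I (f i)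

lemma X_mem_max (i : Fin n) : (X i : MvPolynomial (Fin n) K) ∈ maxIdeal K n := Ideal.subset_span ⟨i, rfl⟩

/-- Build `Nice` from a pair of inverse maps. -/
lemma Nice.mk' {I : Ideal (MvPolynomial (Fin n) K)} (D : Type) [CommRing D] [Algebra K D] [Algebra (MvPolynomial (Fin 2) K) D]
    [Module.Free (MvPolynomial (Fin 2) K) D] [Algebra.IsIntegral (MvPolynomial (Fin 2) K) D]
    (F : MvPolynomial (Fin n) K →ₐ[K] D) (hF : ∀ p ∈ I, F p = 0) (G : D →ₐ[K] MvPolynomial (Fin n) K ⧸ I)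
    (hGF : ∀ i, G (F (X i)) = Ideal.Quotient.mk I (X i))
    (hFG : ∀ F' : (MvPolynomial (Fin n) K ⧸ I) →ₐ[K] D, (∀ p, F' (Ideal.Quotient.mk I p) = F p) → F'.comp G = AlgHom.id K D)
    (f : Fin 2 → MvPolynomial (Fin n) K) (hf : ∀ i, f i ∈ maxIdeal K n)
    (hφ : ∀ i, G (algebraMap (MvPolynomial (Fin 2) K) D (X i)) = Ideal.Quotient.mk I (f i)) : Nice I := by
  let E : (MvPolynomial (Fin n) K ⧸ I) ≃ₐ[K] D := AlgEquiv.ofAlgHom (Ideal.Quotient.liftₐ I F hF) G (hFG _ fun p => rfl) (by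
    apply Ideal.Quotient.algHom_ext
    apply MvPolynomial.algHom_ext
    intro i
    simp only [AlgHom.comp_apply, AlgHom.id_apply]
    exact hGF i)
  exact ⟨_, Good.of_equiv D E.toRingEquiv, f, hf, hφ⟩

lemma nice0 {a b : Fin n} (hab : a ≠ b) (hc : ∀ x, x = a ∨ x = b) : Nice (⊥ : Ideal (MvPolynomial (Fin n) K)) := by
  refine Nice.mk' (MvPolynomial (Fin 2) K) (aeval fun i => if i = a then X 0 else X 1) (by simp)
    (aeval ![Ideal.Quotient.mk _ (X a), Ideal.Quotient.mk _ (X b)]) ?_ ?_ ![X a, X b] ?_ ?_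
  · intro i
    rcases hc i with rfl | rfl
    · simp
    · simp [hab.symm]
  · intro F' hF'
    apply MvPolynomial.algHom_ext
    intro i
    fin_cases i
    · simp [hF']
    · simp [hF', hab.symm]
  · intro i; fin_cases i <;> exact X_mem_max _
  · intro i; fin_cases i <;> simp

lemma nice1 {x y z : Fin n} (hxy : x ≠ y) (hxz : x ≠ z) (hyz : y ≠ z) (hc : ∀ i, i = x ∨ i = y ∨ i = z) {δ : ℕ}
    (hδ : δ = 0 ∨ δ = 1) (m : ℕ) :
    Nice (Ideal.span {(X x * X y * X z ^ δ : MvPolynomial (Fin n) K)} ^ m) := by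
  obtain ⟨p, hp⟩ : ∃ p : Polynomial (MvPolynomial (Fin 2) K), p = (Polynomial.X * (Polynomial.X + Polynomial.C (X 0)) *
    ((δ : Polynomial (MvPolynomial (Fin 2) K)) * Polynomial.X + Polynomial.C (X 1)) ^ δ) ^ m := ⟨_, rfl⟩
  have hmon : p.Monic := by
    rw [hp]
    apply Polynomial.Monic.pow
    rcases hδ with rfl | rfl
    · simpa using Polynomial.monic_X.mul (Polynomial.monic_X_add_C _)
    · simpa using (Polynomial.monic_X.mul (Polynomial.monic_X_add_C _)).mul (Polynomial.monic_X_add_C _)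
  have := hmon.free_adjoinRoot
  have := hmon.finite_adjoinRoot
  have h0 : (AdjoinRoot.root p * (AdjoinRoot.root p + AdjoinRoot.of p (X 0)) * (δ * AdjoinRoot.root p + AdjoinRoot.of p (X 1)) ^ δ) ^ m = 0 := by
    have := AdjoinRoot.eval₂_root p
    conv at this => 
      lhs; arg 3; rw [hp]
    simpa [Polynomial.eval₂_pow, Polynomial.eval₂_mul] using this
  refine Nice.mk' (AdjoinRoot p) (aeval fun i => if i = x then AdjoinRoot.root p else if i = y then AdjoinRoot.root p + AdjoinRoot.of p (X 0) else
     δ * AdjoinRoot.root p + AdjoinRoot.of p (X 1)) ?_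
    (AdjoinRoot.liftAlgHom p (aeval ![Ideal.Quotient.mk _ (X y - X x), Ideal.Quotient.mk _ (X z - (δ : MvPolynomial (Fin n) K) * X x)])
      (Ideal.Quotient.mk _ (X x)) ?_) ?_ ?_ ![X y - X x, X z - (δ : MvPolynomial (Fin n) K) * X x] ?_ ?_
  · rw [Ideal.span_singleton_pow]
    intro q hq
    obtain ⟨q, rfl⟩ := Ideal.mem_span_singleton.1 hq
    rw [map_mul]
    convert zero_mul _
    rw [← h0]
    simp [hxy.symm, hxz.symm, hyz.symm]
  · have : Ideal.Quotient.mk (Ideal.span {(X x * X y * X z ^ δ : MvPolynomial (Fin n) K)} ^ m) ((X x * X y * X z ^ δ) ^ m) = 0 :=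
      Ideal.Quotient.eq_zero_iff_mem.2 (Ideal.pow_mem_pow (Ideal.mem_span_singleton_self _) m)
    rw [hp, ← this]
    simp [Polynomial.eval₂_pow, Polynomial.eval₂_mul]
  · intro i
    rcases hc i with rfl | rfl | rfl
    · simp
    · simp [hxy.symm]
    · simp [hxz.symm, hyz.symm]
  · intro F' hF'
    apply AdjoinRoot.algHom_ext'
    · apply MvPolynomial.algHom_ext
      intro i
      fin_cases i
      · simp [hF', hxy.symm]
      · simp [hF', hxz.symm, hyz.symm]
    · simp [hF']
  · intro i; fin_cases i
    · exact sub_mem (X_mem_max _) (X_mem_max _)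
    · exact sub_mem (X_mem_max _) (Ideal.mul_mem_left _ _ (X_mem_max _))
  · intro i; fin_cases i <;> simp
end
end GraphAux

namespace GraphAux
open MvPolynomial

section
variable {K : Type} [Field K] {n : ℕ}
open TensorProduct

lemma trunc_integral (m : ℕ) : Algebra.IsIntegral K (MvPolynomial (Fin 2) K ⧸ (Ideal.span {X 0, X 1} : Ideal (MvPolynomial (Fin 2) K)) ^ m) := by
  constructor
  intro x
  obtain ⟨p, rfl⟩ := Ideal.Quotient.mk_surjective x
  refine ⟨(Polynomial.X - Polynomial.C (constantCoeff p)) ^ m, (Polynomial.monic_X_sub_C _).pow m, ?_⟩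
  have : p - C (constantCoeff p) ∈ (Ideal.span {X 0, X 1} : Ideal (MvPolynomial (Fin 2) K)) := by
    have : (Ideal.span {X 0, X 1} : Ideal (MvPolynomial (Fin 2) K)) = Ideal.span (X '' Set.univ) := by
      congr 1
      ext q
      simp [Fin.exists_fin_two, eq_comm]
    rw [this, mem_ideal_span_X_image]
    intro d hd
    by_contra! hcon
    have : d = 0 := by ext i; simpa using hcon i
    subst this
    simp [constantCoeff_eq] at hd
  have := Ideal.Quotient.eq_zero_iff_mem.2 (Ideal.pow_mem_pow this m)
  rw [← this]
  simp [Polynomial.eval₂_pow]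
  rfl

lemma monic2 {C : Type} [CommRing C] (b c : C) : (Polynomial.X * (Polynomial.X + Polynomial.C b) - Polynomial.C c).Monic := by
  nontriviality C
  apply Polynomial.Monic.sub_of_left (Polynomial.monic_X.mul (Polynomial.monic_X_add_C _))
  refine lt_of_le_of_lt Polynomial.degree_C_le ?_
  rw [Polynomial.degree_eq_natDegree (Polynomial.monic_X.mul (Polynomial.monic_X_add_C _)).ne_zero,
    Polynomial.Monic.natDegree_mul Polynomial.monic_X (Polynomial.monic_X_add_C _)]
  simp

lemma nice2_tower {a c b d : Fin n} (hac : a ≠ c) (hab : a ≠ b) (had : a ≠ d) (hcb : c ≠ b) (hcd : c ≠ d) (hbd : b ≠ d)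
    (hc : ∀ i, i = a ∨ i = c ∨ i = b ∨ i = d) (m : ℕ) (C1 : Type) [CommRing C1] [Algebra K C1] [Algebra (MvPolynomial (Fin 2) K) C1]
    [Module.Free (MvPolynomial (Fin 2) K) C1] [Algebra.IsIntegral (MvPolynomial (Fin 2) K) C1] (P Q U V : C1)
    (hU : algebraMap (MvPolynomial (Fin 2) K) C1 (X 0) = U) (hV : algebraMap (MvPolynomial (Fin 2) K) C1 (X 1) = V)
    (hPQ : Ideal.span {P, Q} ^ m = ⊥)
    (I : Ideal (MvPolynomial (Fin n) K)) (hI : I = Ideal.span {(X a * X c : MvPolynomial (Fin n) K), X b * X d} ^ m)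
    (G1 : C1 →ₐ[K] MvPolynomial (Fin n) K ⧸ I) (hGU : G1 U = Ideal.Quotient.mk I (X c - X a)) (hGV : G1 V = Ideal.Quotient.mk I (X d - X b))
    (hGP : G1 P = Ideal.Quotient.mk I (X a * X c)) (hGQ : G1 Q = Ideal.Quotient.mk I (X b * X d))
    (hext : ∀ (T : Type) [CommRing T] [Algebra K T] (f g : C1 →ₐ[K] T), f U = g U → f V = g V → f P = g P → f Q = g Q → f = g) :
    Nice I := by
  obtain ⟨p, hp'⟩ : ∃ p : Polynomial C1, p = Polynomial.X * (Polynomial.X + Polynomial.C U) - Polynomial.C P := ⟨_, rfl⟩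
  have hp : p.Monic := by rw [hp']; exact monic2 _ _
  obtain ⟨q, hq'⟩ : ∃ q : Polynomial (AdjoinRoot p), q = Polynomial.X * (Polynomial.X + Polynomial.C (AdjoinRoot.of p V)) - 
    Polynomial.C (AdjoinRoot.of p Q) := ⟨_, rfl⟩
  have hq : q.Monic := by rw [hq']; exact monic2 _ _
  have := hp.free_adjoinRoot
  have := hp.finite_adjoinRoot
  have := hq.free_adjoinRoot
  have := hq.finite_adjoinRoot
  have : Module.Free (MvPolynomial (Fin 2) K) (AdjoinRoot p) := Module.Free.trans (S := C1)
  have : Module.Free (MvPolynomial (Fin 2) K) (AdjoinRoot q) := Module.Free.trans (S := AdjoinRoot p)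
  have : Algebra.IsIntegral (MvPolynomial (Fin 2) K) (AdjoinRoot p) := Algebra.IsIntegral.trans C1
  have : Algebra.IsIntegral (MvPolynomial (Fin 2) K) (AdjoinRoot q) := Algebra.IsIntegral.trans (AdjoinRoot p)
  obtain ⟨ψ, hψ⟩ : ∃ ψ : C1 →ₐ[K] (AdjoinRoot q), ψ = (AdjoinRoot.ofAlgHom K q).comp (AdjoinRoot.ofAlgHom K p) := ⟨_, rfl⟩
  have hψ' : ∀ x, AdjoinRoot.of q (AdjoinRoot.of p x) = ψ x := fun x => by rw [hψ]; rfl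
  obtain ⟨α, hα'⟩ : ∃ α : (AdjoinRoot q), α = AdjoinRoot.of q (AdjoinRoot.root p) := ⟨_, rfl⟩
  obtain ⟨β, hβ'⟩ : ∃ β : (AdjoinRoot q), β = AdjoinRoot.root q := ⟨_, rfl⟩
  have hα : α * (α + ψ U) = ψ P := by
    have := AdjoinRoot.eval₂_root p
    conv at this =>
      lhs; arg 3; rw [hp']
    have := congrArg (AdjoinRoot.of q) this
    simp only [Polynomial.eval₂_sub, Polynomial.eval₂_mul, Polynomial.eval₂_add, Polynomial.eval₂_X, Polynomial.eval₂_C, map_sub, map_mul, map_add,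
      map_zero, hψ', sub_eq_zero] at this
    rwa [← hα'] at this
  have hβ : β * (β + ψ V) = ψ Q := by
    have := AdjoinRoot.eval₂_root q
    conv at this =>
      lhs; arg 3; rw [hq']
    simp only [Polynomial.eval₂_sub, Polynomial.eval₂_mul, Polynomial.eval₂_add, Polynomial.eval₂_X, Polynomial.eval₂_C, map_sub, map_mul, map_add,
      map_zero, hψ', sub_eq_zero] at this
    rwa [← hβ'] at this
  let F : MvPolynomial (Fin n) K →ₐ[K] (AdjoinRoot q) := 
    aeval fun i => if i = a then α else if i = c then α + ψ U else if i = b then β else β + ψ V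
  have hFa : F (X a) = α := by simp [F]
  have hFc : F (X c) = α + ψ U := by simp [F, hac.symm]
  have hFb : F (X b) = β := by simp [F, hab.symm, hcb.symm]
  have hFd : F (X d) = β + ψ V := by simp [F, had.symm, hcd.symm, hbd.symm]
  let G2 : AdjoinRoot p →ₐ[K] MvPolynomial (Fin n) K ⧸ I := AdjoinRoot.liftAlgHom p G1 (Ideal.Quotient.mk I (X a)) (by
    rw [hp']
    simp [Polynomial.eval₂_mul, hGU, hGP])
  let G : (AdjoinRoot q) →ₐ[K] MvPolynomial (Fin n) K ⧸ I := AdjoinRoot.liftAlgHom q G2 (Ideal.Quotient.mk I (X b)) (by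
    rw [hq']
    simp [Polynomial.eval₂_mul, G2, hGV, hGQ])
  have hGψ : ∀ x, G (ψ x) = G1 x := fun x => by
    rw [← hψ']; simp [G, G2]
  have hGα : G α = Ideal.Quotient.mk I (X a) := by simp [hα', G, G2]
  have hGβ : G β = Ideal.Quotient.mk I (X b) := by simp [hβ', G]
  refine Nice.mk' (AdjoinRoot q) F ?_ G ?_ ?_ ![X c - X a, X d - X b] ?_ ?_
  · have h1 : I.map F ≤ ⊥ := by
      rw [hI, Ideal.map_pow, Ideal.map_span, Set.image_pair, map_mul, map_mul, hFa, hFb, hFc, hFd, hα, hβ]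
      have := congrArg (Ideal.map ψ) hPQ
      rw [Ideal.map_pow, Ideal.map_span, Set.image_pair, Ideal.map_bot] at this
      exact this.le
    intro x hx
    simpa using h1 (Ideal.mem_map_of_mem F hx)
  · intro i
    rcases hc i with rfl | rfl | rfl | rfl
    · rw [hFa, hGα]
    · rw [hFc, map_add, hGα, hGψ, hGU]; simp
    · rw [hFb, hGβ]
    · rw [hFd, map_add, hGβ, hGψ, hGV]; simp
  · intro F' hF'
    apply AdjoinRoot.algHom_ext'
    · apply AdjoinRoot.algHom_ext'
      · have key : (F'.comp G).comp ψ = ψ := by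
          apply hext
          · simp only [AlgHom.comp_apply, hGψ, hGU, hF']; simp [hFa, hFc]
          · simp only [AlgHom.comp_apply, hGψ, hGV, hF']; simp [hFb, hFd]
          · simp only [AlgHom.comp_apply, hGψ, hGP, hF']; simp [hFa, hFc, hα]
          · simp only [AlgHom.comp_apply, hGψ, hGQ, hF']; simp [hFb, hFd, hβ]
        rw [AlgHom.comp_assoc, ← hψ, key, AlgHom.id_comp, ← hψ]
      · change F' (G (AdjoinRoot.of q (AdjoinRoot.root p))) = (AdjoinRoot.of q (AdjoinRoot.root p))
        rw [← hα', hGα, hF', hFa]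
    · change F' (G (AdjoinRoot.root q)) = AdjoinRoot.root q
      rw [← hβ', hGβ, hF', hFb]
  · intro i; fin_cases i <;> exact sub_mem (X_mem_max _) (X_mem_max _)
  · have e : ∀ r, algebraMap (MvPolynomial (Fin 2) K) (AdjoinRoot q) r = ψ (algebraMap _ C1 r) := fun r => by
      rw [← hψ']; rfl
    intro i; fin_cases i
    · simp only [e]
      rw [hGψ]
      exact (congrArg G1 hU).trans hGU
    · simp only [e]
      rw [hGψ]
      exact (congrArg G1 hV).trans hGV

lemma span_pair_pow {A B : Type} [CommRing A] [CommRing B] {J : Ideal A} {x y : A} {m : ℕ} (hJ : J = Ideal.span {x, y} ^ m)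
    (h : A ⧸ J →+* B) : Ideal.span {h (Ideal.Quotient.mk J x), h (Ideal.Quotient.mk J y)} ^ m = ⊥ := by
  have h1 : J.map (h.comp (Ideal.Quotient.mk J)) = ⊥ := by
    rw [← Ideal.map_map, Ideal.map_quotient_self, Ideal.map_bot]
  have h2 : (Ideal.span {x, y} ^ m).map (h.comp (Ideal.Quotient.mk J)) = ⊥ := (congrArg (Ideal.map _) hJ.symm).trans h1
  rw [Ideal.map_pow, Ideal.map_span, Set.image_pair] at h2
  exact h2

lemma tensor_pow (B C0 : Type) [CommRing B] [Algebra K B] [CommRing C0] [Algebra K C0] (P Q : C0) (m : ℕ) (h : Ideal.span {P, Q} ^ m = ⊥) :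
    Ideal.span {(1 ⊗ₜ P : B ⊗[K] C0), 1 ⊗ₜ Q} ^ m = ⊥ := by
  have := congrArg (Ideal.map (Algebra.TensorProduct.includeRight : C0 →ₐ[K] B ⊗[K] C0)) h
  rw [Ideal.map_pow, Ideal.map_span, Set.image_pair, Ideal.map_bot] at this
  exact this

lemma nice2 {a c b d : Fin n} (hac : a ≠ c) (hab : a ≠ b) (had : a ≠ d) (hcb : c ≠ b) (hcd : c ≠ d) (hbd : b ≠ d)
    (hc : ∀ i, i = a ∨ i = c ∨ i = b ∨ i = d) (m : ℕ) :
    Nice (Ideal.span {(X a * X c : MvPolynomial (Fin n) K), X b * X d} ^ m) := by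
  have hint := trunc_integral (K := K) m
  obtain ⟨J, hJ⟩ : ∃ J : Ideal (MvPolynomial (Fin 2) K), J = Ideal.span {X 0, X 1} ^ m := ⟨_, rfl⟩
  obtain ⟨I, hI⟩ : ∃ I, I = Ideal.span {(X a * X c : MvPolynomial (Fin n) K), X b * X d} ^ m := ⟨_, rfl⟩
  rw [← hJ] at hint
  rw [← hI]
  let g0 : MvPolynomial (Fin 2) K →ₐ[K] MvPolynomial (Fin n) K := aeval ![(X a * X c), (X b * X d)]
  let G0 : (MvPolynomial (Fin 2) K ⧸ J) →ₐ[K] MvPolynomial (Fin n) K ⧸ I := Ideal.Quotient.liftₐ J ((Ideal.Quotient.mkₐ K I).comp g0) (by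
    have h1 : J.map g0 ≤ I := by
      rw [hJ, hI, Ideal.map_pow, Ideal.map_span, Set.image_pair]
      simp [g0]
    intro x hx
    exact Ideal.Quotient.eq_zero_iff_mem.2 (h1 (Ideal.mem_map_of_mem g0 hx)))
  have hG0 : ∀ x, G0 (Ideal.Quotient.mk J x) = Ideal.Quotient.mk I (g0 x) := fun x => rfl
  let g1 : MvPolynomial (Fin 2) K →ₐ[K] MvPolynomial (Fin n) K ⧸ I := aeval ![Ideal.Quotient.mk I (X c - X a), Ideal.Quotient.mk I (X d - X b)]
  refine nice2_tower hac hab had hcb hcd hbd hc m (MvPolynomial (Fin 2) K ⊗[K] (MvPolynomial (Fin 2) K ⧸ J))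
    (1 ⊗ₜ Ideal.Quotient.mk J (X 0)) (1 ⊗ₜ Ideal.Quotient.mk J (X 1)) (X 0 ⊗ₜ 1) (X 1 ⊗ₜ 1) ?_ ?_ ?_ I hI
    (Algebra.TensorProduct.productMap g1 G0) ?_ ?_ ?_ ?_ ?_
  · rfl
  · rfl
  · apply tensor_pow
    exact span_pair_pow hJ (RingHom.id _)
  · simp [g1]
  · simp [g1]
  · simp [hG0, g0]
  · simp [hG0, g0]
  · intro T _ _ f g h1 h2 h3 h4
    apply Algebra.TensorProduct.ext'
    intro x y
    have e1 : f.comp Algebra.TensorProduct.includeLeft = g.comp Algebra.TensorProduct.includeLeft := by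
      apply MvPolynomial.algHom_ext
      intro i; fin_cases i
      · exact h1
      · exact h2
    have e2 : f.comp Algebra.TensorProduct.includeRight = g.comp Algebra.TensorProduct.includeRight := by
      apply Ideal.Quotient.algHom_ext
      apply MvPolynomial.algHom_ext
      intro i; fin_cases i
      · exact h3
      · exact h4
    have e1' := DFunLike.congr_fun e1 x
    have e2' := DFunLike.congr_fun e2 y
    have : x ⊗ₜ[K] y = (x ⊗ₜ[K] 1) * (1 ⊗ₜ[K] y) := by simp
    rw [this, map_mul, map_mul]
    exact congrArg₂ _ e1' e2'
end
end GraphAux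

namespace GraphAux
open MvPolynomial

section
variable {K : Type} [Field K] {n : ℕ}

lemma exists_min {Δ : SimComplex n} (hV : ∀ i : Fin n, ({i} : Finset (Fin n)) ∈ Δ.faces) (F : Finset (Fin n)) (hF : F ∉ Δ.faces) :
    ∃ G ⊆ F, Δ.IsMinNonface G := by
  induction F using Finset.strongInduction with
  | H F ih =>
    by_cases h : ∀ G ⊂ F, G ∈ Δ.faces
    · exact ⟨F, subset_rfl, fun i _ => hV i, hF, h⟩
    · push Not at h
      obtain ⟨G, hG, hG'⟩ := h
      obtain ⟨H, hH, hm⟩ := ih G hG hG'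
      exact ⟨H, hH.trans hG.1, hm⟩

lemma SR_eq {Δ : SimComplex n} (hV : ∀ i : Fin n, ({i} : Finset (Fin n)) ∈ Δ.faces) (T : Set (Finset (Fin n)))
    (h1 : ∀ F ∈ T, Δ.IsMinNonface F) (h2 : ∀ F, Δ.IsMinNonface F → F ∈ T) :
    SRIdeal K Δ = Ideal.span (faceMonomial K '' T) := by
  apply le_antisymm
  · rw [SRIdeal, Ideal.span_le]
    rintro _ ⟨F, hF, rfl⟩
    obtain ⟨G, hG, hm⟩ := exists_min hV F hF
    refine Ideal.mem_of_dvd _ (Finset.prod_dvd_prod_of_subset _ _ _ hG) (Ideal.subset_span ⟨G, h2 G hm, rfl⟩)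
  · rw [Ideal.span_le]
    rintro _ ⟨F, hF, rfl⟩
    exact Ideal.subset_span ⟨F, (h1 F hF).2.1, rfl⟩

lemma nice_pair {Δ : SimComplex n} (hV : ∀ i : Fin n, ({i} : Finset (Fin n)) ∈ Δ.faces)
    (hCI : Δ.IsCompleteIntersection) {m : ℕ} {a b z : Fin n} (hab : a ≠ b) (haz : a ≠ z) (hbz : b ≠ z)
    (hz : Δ.IsMinNonface {a, z}) (hempty : ∅ ∈ Δ.faces)
    (key : ∀ w, w ≠ a → w ≠ b → ∃ F, Δ.IsMinNonface F ∧ F ⊆ {a, b, w} ∧ w ∈ F ∧ (a ∈ F ∨ b ∈ F)) :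
    Nice (SRIdeal K Δ ^ m) := by
  by_cases hw : ∃ w, w ≠ a ∧ w ≠ b ∧ w ≠ z
  · obtain ⟨w, hwa, hwb, hwz⟩ := hw
    obtain ⟨F, hF, hFs, hwF, hFab⟩ := key w hwa hwb
    have hd : Disjoint F {a, z} := hCI _ _ hF hz (by rintro rfl; simp [hwa, hwz] at hwF)
    have haF : a ∉ F := fun h => Finset.disjoint_left.1 hd h (by simp)
    have hFe : F = {b, w} := by
      apply Finset.Subset.antisymm
      · intro x hx
        have := hFs hx
        simp only [Finset.mem_insert, Finset.mem_singleton] at this ⊢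
        rcases this with rfl | h
        · exact absurd hx haF
        · exact h
      · intro x hx
        simp only [Finset.mem_insert, Finset.mem_singleton] at hx
        rcases hx with rfl | rfl
        · exact hFab.resolve_left haF
        · exact hwF
    subst hFe
    have hcov : ∀ i, i = a ∨ i = z ∨ i = b ∨ i = w := by
      intro t
      by_contra! hcon
      obtain ⟨hta, htz, htb, htw⟩ := hcon
      obtain ⟨G, hG, hGs, htG, hGab⟩ := key t hta htb
      rcases hGab with h | h
      · exact Finset.disjoint_left.1 (hCI _ _ hG hz (by rintro rfl; simp [hta, htz] at htG)) h (by simp)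
      · exact Finset.disjoint_left.1 (hCI _ _ hG hF (by rintro rfl; simp [htb, htw] at htG)) h (by simp)
    have := SR_eq (K := K) hV {{a, z}, {b, w}} (by rintro G (rfl | rfl) <;> assumption) (by
      intro G hG
      by_contra hcon
      simp only [Set.mem_insert_iff, Set.mem_singleton_iff, not_or] at hcon
      have d1 := Finset.disjoint_left.1 (hCI _ _ hG hz hcon.1)
      have d2 := Finset.disjoint_left.1 (hCI _ _ hG hF hcon.2)
      have : G = ∅ := by
        rw [Finset.eq_empty_iff_forall_notMem]
        intro x hx
        have e1 := d1 hx
        have e2 := d2 hx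
        simp only [Finset.mem_insert, Finset.mem_singleton, not_or] at e1 e2
        rcases hcov x with h | h | h | h <;> tauto
      exact hG.2.1 (this ▸ hempty))
    rw [this, Set.image_pair]
    simp only [faceMonomial, Finset.prod_pair haz, Finset.prod_pair hwb.symm]
    exact nice2 haz hab hwa.symm hbz.symm hwz.symm hwb.symm hcov m
  · push Not at hw
    have := SR_eq (K := K) hV {{a, z}} (by rintro G rfl; assumption) (by
      intro G hG
      by_contra hcon
      simp only [Set.mem_singleton_iff] at hcon
      have d1 := Finset.disjoint_left.1 (hCI _ _ hG hz hcon)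
      refine hG.2.1 (Δ.down_closed (hV b) fun x hx => ?_)
      have e1 := d1 hx
      simp only [Finset.mem_insert, Finset.mem_singleton, not_or] at e1 ⊢
      by_contra hb
      exact e1.2 (hw x e1.1 hb))
    rw [this, Set.image_singleton]
    simp only [faceMonomial, Finset.prod_pair haz]
    have := nice1 (K := K) haz hab hbz.symm (fun i => by 
      by_contra! hcon
      exact hcon.2.1 (hw i hcon.1 hcon.2.2)) (Or.inl rfl) m
    simpa using this

lemma nice_of_CI {Δ : SimComplex n} (hV : ∀ i : Fin n, ({i} : Finset (Fin n)) ∈ Δ.faces)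
    (hgraph : ∀ F ∈ Δ.faces, F.card ≤ 2) (hedge : ∃ F ∈ Δ.faces, F.card = 2)
    (hCI : Δ.IsCompleteIntersection) {m : ℕ} (hm : m ≠ 0) : Nice (SRIdeal K Δ ^ m) := by
  obtain ⟨E, hE, hcE⟩ := hedge
  obtain ⟨a, b, hab, rfl⟩ := Finset.card_eq_two.1 hcE
  have hempty : ∅ ∈ Δ.faces := Δ.down_closed hE (by simp)
  have key : ∀ w, w ≠ a → w ≠ b → ∃ F, Δ.IsMinNonface F ∧ F ⊆ {a, b, w} ∧ w ∈ F ∧ (a ∈ F ∨ b ∈ F) := by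
    intro w hwa hwb
    have hn : ({a, b, w} : Finset (Fin n)) ∉ Δ.faces := by
      intro h
      have := hgraph _ h
      rw [Finset.card_eq_three.2 ⟨a, b, w, hab, hwa.symm, hwb.symm, rfl⟩] at this
      omega
    obtain ⟨F, hFs, hF⟩ := exists_min hV _ hn
    refine ⟨F, hF, hFs, ?_, ?_⟩
    · by_contra hwF
      refine hF.2.1 (Δ.down_closed hE fun x hx => ?_)
      have := hFs hx
      simp only [Finset.mem_insert, Finset.mem_singleton] at this ⊢
      rcases this with h | h | rfl
      · exact Or.inl h
      · exact Or.inr h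
      · exact absurd hx hwF
    · by_contra! hcon
      refine hF.2.1 (Δ.down_closed (hV w) fun x hx => ?_)
      have := hFs hx
      simp only [Finset.mem_insert, Finset.mem_singleton] at this ⊢
      rcases this with rfl | rfl | h
      · exact absurd hx hcon.1
      · exact absurd hx hcon.2
      · exact h
  by_cases hz : ∃ z, z ≠ a ∧ z ≠ b
  · obtain ⟨z, hza, hzb⟩ := hz
    obtain ⟨F, hF, hFs, hzF, hFab⟩ := key z hza hzb
    by_cases ha : a ∈ F
    · by_cases hb : b ∈ F
      · have hFe : F = {a, b, z} := by
          apply Finset.Subset.antisymm hFs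
          intro x hx
          simp only [Finset.mem_insert, Finset.mem_singleton] at hx
          rcases hx with rfl | rfl | rfl <;> assumption
        subst hFe
        have hcov : ∀ i, i = a ∨ i = b ∨ i = z := by
          intro t
          by_contra! hcon
          obtain ⟨hta, htb, htz⟩ := hcon
          obtain ⟨G, hG, hGs, htG, hGab⟩ := key t hta htb
          have hd := Finset.disjoint_left.1 (hCI _ _ hG hF (by rintro rfl; simp [hta, htz, htb] at htG))
          rcases hGab with h | h
          · exact hd h ha
          · exact hd h hb
        have := SR_eq (K := K) hV {{a, b, z}} (by rintro G rfl; assumption) (by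
          intro G hG
          by_contra hcon
          simp only [Set.mem_singleton_iff] at hcon
          have d1 := Finset.disjoint_left.1 (hCI _ _ hG hF hcon)
          refine hG.2.1 (Δ.down_closed hempty fun x hx => ?_)
          refine absurd ?_ (d1 hx)
          simpa using hcov x)
        rw [this, Set.image_singleton]
        have e : faceMonomial K {a, b, z} = X a * X b * X z ^ 1 := by
          rw [faceMonomial, Finset.prod_insert (by simp [hab, hza.symm]), Finset.prod_pair hzb.symm, pow_one, mul_assoc]
        rw [e]
        exact nice1 hab hza.symm hzb.symm hcov (Or.inr rfl) m
      · have hFe : F = {a, z} := by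
          apply Finset.Subset.antisymm
          · intro x hx
            have := hFs hx
            simp only [Finset.mem_insert, Finset.mem_singleton] at this ⊢
            rcases this with h | rfl | h
            · exact Or.inl h
            · exact absurd hx hb
            · exact Or.inr h
          · intro x hx
            simp only [Finset.mem_insert, Finset.mem_singleton] at hx
            rcases hx with rfl | rfl <;> assumption
        subst hFe
        exact nice_pair hV hCI hab hza.symm hzb.symm hF hempty key
    · have hb := hFab.resolve_left ha
      have hFe : F = {b, z} := by
        apply Finset.Subset.antisymm
        · intro x hx
          have := hFs hx
          simp only [Finset.mem_insert, Finset.mem_singleton] at this ⊢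
          rcases this with rfl | h
          · exact absurd hx ha
          · exact h
        · intro x hx
          simp only [Finset.mem_insert, Finset.mem_singleton] at hx
          rcases hx with rfl | rfl <;> assumption
      subst hFe
      refine nice_pair hV hCI hab.symm hzb.symm hza.symm hF hempty fun w hwb hwa => ?_
      obtain ⟨G, hG, hGs, hwG, hGab⟩ := key w hwa hwb
      refine ⟨G, hG, ?_, hwG, hGab.symm⟩
      rw [Finset.insert_comm]
      exact hGs
  · push Not at hz
    have hcov : ∀ x, x = a ∨ x = b := fun x => by
      by_cases h : x = a
      · exact Or.inl h
      · exact Or.inr (hz x h)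
    have := SR_eq (K := K) hV ∅ (by simp) (by
      intro G hG
      exfalso
      refine hG.2.1 (Δ.down_closed hE fun x _ => ?_)
      simpa using hcov x)
    rw [this, Set.image_empty, Ideal.span_empty, ← Ideal.zero_eq_bot, zero_pow hm]
    exact nice0 hab hcov
end
end GraphAux

open GraphAux in
theorem graph_ordinary_powers_Buchsbaum_iff_CI (K : Type) [Field K] {n : ℕ}
    (Δ : SimComplex n)
    (hV : ∀ i : Fin n, ({i} : Finset (Fin n)) ∈ Δ.faces)
    (hgraph : ∀ F ∈ Δ.faces, F.card ≤ 2)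
    (hedge : ∃ F ∈ Δ.faces, F.card = 2)
    (hiso : ∀ v : Fin n, ∃ w : Fin n, w ≠ v ∧ ({v, w} : Finset (Fin n)) ∈ Δ.faces) :
    List.TFAE
      [∀ m : ℕ, 1 ≤ m → IsCohenMacaulayIdeal (SRIdeal K Δ ^ m),
       ∃ m : ℕ, 4 ≤ m ∧ IsBuchsbaum K (SRIdeal K Δ ^ m),
       ∃ m : ℕ, 4 ≤ m ∧ IsQuasiBuchsbaum K (SRIdeal K Δ ^ m),
       Δ.IsCompleteIntersection] := by
  tfae_have 4 → 1 := by
    intro h m hm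
    obtain ⟨φ, hφ, -⟩ := nice_of_CI (K := K) hV hgraph hedge h (m := m) (by omega)
    exact hφ.CM dimR
  tfae_have 4 → 2 := by
    intro h
    obtain ⟨φ, hφ, f, hf, hfφ⟩ := nice_of_CI (K := K) hV hgraph hedge h (m := 4) (by omega)
    exact ⟨4, le_rfl, hφ.B f hf hfφ⟩
  tfae_have 2 → 3 := by
    rintro ⟨m, hm, h⟩
    exact ⟨m, hm, qB_of_B h⟩
  tfae_have 3 → 4 := by
    rintro ⟨m, hm, h⟩
    exact CI_of_Q hgraph hm (Q_of_qB hedge (by omega) h) hV hiso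
  tfae_have 1 → 4 := by
    intro h
    exact CI_of_Q hgraph le_rfl (Q_of_CM hedge (by omega) (h 4 (by omega))) hV hiso
  tfae_finish
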